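/- arXiv:1211.2438 — 6 statements merged into one kernel-verified Lean document; each statement's English description precedes it below -/
import Mathlib

section
/- If ψ : S¹ → ℝ is C¹, then L ψ is C¹ and its derivative satisfies the pointwise bound |(L ψ)'(x)| ≤ (1/λ)·(L|ψ'|)(x) + (‖T''‖_∞/λ²)·(L|ψ|)(x) for all x ∈ S¹. -/
open MeasureTheory Real


theorem aux_surj (F : ℝ → ℝ) (hF : ContDiff ℝ 2 F) (lam : ℝ) (hlam : 1 < lam)
    (hexp : ∀ x : ℝ, lam ≤ deriv F x) : StrictMono F ∧ Function.Surjective F := by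
  have hd : Differentiable ℝ F := hF.differentiable (by norm_num)
  have hm : Monotone (fun x => F x - x) := by
    apply monotone_of_deriv_nonneg (by fun_prop)
    intro x
    have h1 : HasDerivAt (fun x => F x - x) (deriv F x - 1) x :=
      (hd x).hasDerivAt.sub (hasDerivAt_id x)
    rw [h1.deriv]
    linarith [hexp x]
  refine ⟨?_, ?_⟩
  · intro a b hab
    have := hm hab.le
    simp only at this
    linarith
  · apply Continuous.surjective hd.continuous
    · apply Filter.tendsto_atTop_mono' _ _ (Filter.tendsto_atTop_add_const_right _ (F 0) Filter.tendsto_id)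
      filter_upwards [Filter.eventually_ge_atTop 0] with x hx
      have := hm hx
      simp only at this
      simp only [id]
      linarith
    · apply Filter.tendsto_atBot_mono' _ _ (Filter.tendsto_atBot_add_const_right _ (F 0) Filter.tendsto_id)
      filter_upwards [Filter.eventually_le_atBot 0] with x hx
      have := hm hx
      simp only at this
      simp only [id]
      linarith

theorem aux_int (F : ℝ → ℝ) (w : ℕ) (hFw : ∀ x : ℝ, F (x + 1) = F x + w) (x : ℝ) (n : ℤ) :
    F (x + n) = F x + n * w := by
  induction n using Int.induction_on with
  | zero => simp
  | succ i ih =>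
    have := hFw (x + i)
    push_cast at *
    rw [← add_assoc, this, ih]; ring
  | pred i ih =>
    have := hFw (x + (-i - 1))
    push_cast at *
    rw [show x + (-(i:ℝ) - 1) + 1 = x + -i by ring, ih] at this
    linarith

theorem aux_coe (a b : ℝ) : (a : UnitAddCircle) = b ↔ ∃ n : ℤ, a = b + n := by
  rw [← sub_eq_zero, ← AddCircle.coe_sub, AddCircle.coe_eq_zero_iff]
  constructor
  · rintro ⟨n, hn⟩
    refine ⟨n, ?_⟩
    simp at hn
    linarith
  · rintro ⟨n, hn⟩
    refine ⟨n, ?_⟩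
    simp [hn]

theorem aux_sum (F : ℝ → ℝ) (w : ℕ) (hw : 0 < w) (hFw : ∀ x : ℝ, F (x + 1) = F x + w)
    (T : UnitAddCircle → UnitAddCircle) (hT : ∀ x : ℝ, T ↑x = (↑(F x) : UnitAddCircle))
    (G : ℝ → ℝ) (hFG : ∀ x, F (G x) = x) (hGF : ∀ x, G (F x) = x)
    (v : UnitAddCircle → ℝ) (x : ℝ) :
    ∑' y : (T ⁻¹' {(x : UnitAddCircle)}), v y = ∑ k : Fin w, v ↑(G (x + (k : ℕ))) := by
  have hmem : ∀ k : Fin w, ((G (x + (k : ℕ)) : ℝ) : UnitAddCircle) ∈ T ⁻¹' {(x : UnitAddCircle)} := by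
    intro k
    simp only [Set.mem_preimage, Set.mem_singleton_iff, hT, hFG]
    rw [aux_coe]
    exact ⟨(k : ℕ), by simp⟩
  let e : Fin w → (T ⁻¹' {(x : UnitAddCircle)}) := fun k => ⟨_, hmem k⟩
  have hinj : Function.Injective e := by
    intro j k hjk
    have h1 : ((G (x + (j : ℕ)) : ℝ) : UnitAddCircle) = (G (x + (k : ℕ)) : ℝ) :=
      congrArg Subtype.val hjk
    rw [aux_coe] at h1
    obtain ⟨n, hn⟩ := h1
    have h2 := congrArg F hn
    rw [aux_int F w hFw, hFG, hFG] at h2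
    have h3 : ((j : ℕ) : ℤ) = (k : ℕ) + n * w := by
      have : (((j : ℕ) : ℤ) : ℝ) = (((k : ℕ) + n * w : ℤ) : ℝ) := by
        push_cast
        linarith
      exact_mod_cast this
    have h4 := congrArg (· % (w : ℤ)) h3
    simp only [Int.add_mul_emod_self_right] at h4
    have hj := j.2
    have hk := k.2
    rw [Int.emod_eq_of_lt (by positivity) (by exact_mod_cast hj),
      Int.emod_eq_of_lt (by positivity) (by exact_mod_cast hk)] at h4
    exact Fin.ext (by exact_mod_cast h4)
  have hsurj : Function.Surjective e := by
    rintro ⟨y, hy⟩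
    obtain ⟨a, rfl⟩ := QuotientAddGroup.mk_surjective y
    have hy' : T (a : UnitAddCircle) = (x : UnitAddCircle) := hy
    rw [hT, aux_coe] at hy'
    obtain ⟨m, hm⟩ := hy'
    have hw' : (0 : ℤ) < w := by exact_mod_cast hw
    have hr0 := Int.emod_nonneg m hw'.ne'
    have hr1 := Int.emod_lt_of_pos m hw'
    have hdm := Int.emod_add_mul_ediv m w
    obtain ⟨r, hr⟩ := Int.eq_ofNat_of_zero_le hr0
    rw [hr] at hr1 hdm
    refine ⟨⟨r, by exact_mod_cast hr1⟩, Subtype.ext ?_⟩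
    change ((G (x + (r : ℕ)) : ℝ) : UnitAddCircle) = (a : UnitAddCircle)
    rw [aux_coe]
    refine ⟨-(m / w), ?_⟩
    have h5 : F (a + (-(m / w) : ℤ)) = x + r := by
      rw [aux_int F w hFw, hm]
      have : (m : ℝ) = r + w * (m / w : ℤ) := by
        have := congrArg (Int.cast : ℤ → ℝ) hdm
        push_cast at this
        linarith
      rw [this]
      push_cast
      ring
    rw [← h5, hGF]
  rw [← (Equiv.ofBijective e ⟨hinj, hsurj⟩).tsum_eq, tsum_fintype]
  rfl

theorem transfer_derivative_bound
    (F : ℝ → ℝ) (hF : ContDiff ℝ 2 F)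
    (w : ℕ) (hw : 0 < w) (hFw : ∀ x : ℝ, F (x + 1) = F x + w)
    (T : UnitAddCircle → UnitAddCircle) (hT : ∀ x : ℝ, T ↑x = (↑(F x) : UnitAddCircle))
    (lam : ℝ) (hlam : 1 < lam) (hexp : ∀ x : ℝ, lam ≤ deriv F x)
    (nT'' : ℝ) (hnT'' : nT'' = ⨆ x : ℝ, |deriv (deriv F) x|)
    (Omega : ℝ) (hOmega : Omega = nT'' / (lam * (lam - 1)))
    (T' : UnitAddCircle → ℝ) (hT'lift : ∀ x : ℝ, T' ↑x = deriv F x)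
    (L : (UnitAddCircle → ℝ) → (UnitAddCircle → ℝ))
    (hL : ∀ u : UnitAddCircle → ℝ, ∀ x : UnitAddCircle,
      L u x = ∑' y : (T ⁻¹' {x}), u y / T' y)
    (ψ : UnitAddCircle → ℝ) (hψ : ContDiff ℝ 1 (fun x : ℝ => ψ ↑x))
    (ψ' : UnitAddCircle → ℝ) (hψ' : ∀ x : ℝ, ψ' ↑x = deriv (fun y : ℝ => ψ ↑y) x) :
    ContDiff ℝ 1 (fun x : ℝ => L ψ ↑x) ∧
    ∀ x : ℝ, |deriv (fun y : ℝ => L ψ ↑y) x| ≤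
      (1 / lam) * L (fun z => |ψ' z|) ↑x + (nT'' / lam ^ 2) * L (fun z => |ψ z|) ↑x := by
  obtain ⟨hmono, hsurj⟩ := aux_surj F hF lam hlam hexp
  have hd : Differentiable ℝ F := hF.differentiable (by norm_num)
  have hdF : ContDiff ℝ 1 (deriv F) := by
    have : ContDiff ℝ (1 + 1) F := by
      convert hF using 1
      norm_num
    exact (contDiff_succ_iff_deriv.1 this).2.2
  have hpos : ∀ x, 0 < deriv F x := fun x => by linarith [hexp x]
  have hddc : Continuous (deriv (deriv F)) := hdF.continuous_deriv le_rfl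
  let e : ℝ ≃ₜ ℝ := (StrictMono.orderIsoOfSurjective F hmono hsurj).toHomeomorph
  have heF : ∀ x, e x = F x := fun x => rfl
  let G : ℝ → ℝ := e.symm
  have hFG : ∀ x, F (G x) = x := fun x => e.apply_symm_apply x
  have hGF : ∀ x, G (F x) = x := fun x => e.symm_apply_apply x
  have hG1 : ContDiff ℝ 1 G :=
    e.contDiff_symm_deriv (f' := deriv F) (fun x => (hpos x).ne') (fun x => (hd x).hasDerivAt)
      (hF.of_le (by norm_num))
  have hGd : ∀ x, HasDerivAt G (deriv F (G x))⁻¹ x := fun x =>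
    HasDerivAt.of_local_left_inverse hG1.continuous.continuousAt (hd _).hasDerivAt
      (hpos _).ne' (Filter.Eventually.of_forall hFG)
  have hsum : ∀ (u : UnitAddCircle → ℝ) (x : ℝ),
      L u ↑x = ∑ k : Fin w, u ↑(G (x + (k : ℕ))) / deriv F (G (x + (k : ℕ))) := by
    intro u x
    rw [hL, aux_sum F w hw hFw T hT G hFG hGF (fun y => u y / T' y) x]
    simp only [hT'lift]
  have hper : Function.Periodic (deriv F) 1 := by
    intro x
    rw [← hT'lift, ← hT'lift]
    congr 1
    exact (aux_coe _ _).2 ⟨1, by simp⟩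
  have hper2 : Function.Periodic (deriv (deriv F)) 1 := by
    intro x
    rw [← deriv_comp_add_const]
    congr 1
    exact funext hper
  have hbdd : ∀ x, |deriv (deriv F) x| ≤ nT'' := by
    obtain ⟨C, hC⟩ := (hper2.isBounded_of_continuous one_ne_zero hddc).exists_norm_le
    intro x
    rw [hnT'']
    refine le_ciSup (f := fun x => |deriv (deriv F) x|) ⟨C, ?_⟩ x
    rintro _ ⟨y, rfl⟩
    exact hC _ ⟨y, rfl⟩
  have hfun : (fun x : ℝ => L ψ ↑x) = fun x : ℝ =>
      ∑ k : Fin w, ψ ↑(G (x + (k : ℕ))) / deriv F (G (x + (k : ℕ))) := funext (hsum ψ)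
  have hψd : Differentiable ℝ (fun x : ℝ => ψ ↑x) := hψ.differentiable (by norm_num)
  rw [hfun]
  refine ⟨?_, ?_⟩
  · refine ContDiff.sum fun k _ => ?_
    have hk : ContDiff ℝ 1 (fun x : ℝ => G (x + (k : ℕ))) :=
      hG1.comp (contDiff_id.add contDiff_const)
    exact (hψ.comp hk).div (hdF.comp hk) (fun x => (hpos _).ne')
  · intro x
    have hder : ∀ k : Fin w, HasDerivAt
        (fun x : ℝ => ψ ↑(G (x + (k : ℕ))) / deriv F (G (x + (k : ℕ))))
        ((ψ' ↑(G (x + (k : ℕ))) * deriv F (G (x + (k : ℕ)))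
          - ψ ↑(G (x + (k : ℕ))) * deriv (deriv F) (G (x + (k : ℕ))))
          / deriv F (G (x + (k : ℕ))) ^ 2 * (deriv F (G (x + (k : ℕ))))⁻¹) x := by
      intro k
      have h1 : HasDerivAt (fun x : ℝ => G (x + (k : ℕ))) (deriv F (G (x + (k : ℕ))))⁻¹ x :=
        (hGd (x + (k : ℕ))).comp_add_const x _
      have h2 := ((hψd (G (x + (k : ℕ)))).hasDerivAt.div
        ((hdF.differentiable (by norm_num)) (G (x + (k : ℕ)))).hasDerivAt (hpos _).ne')
      rw [← hψ'] at h2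
      exact h2.comp x h1
    rw [(HasDerivAt.fun_sum fun k _ => hder k).deriv, hsum, hsum, Finset.mul_sum, Finset.mul_sum,
      ← Finset.sum_add_distrib]
    refine (Finset.abs_sum_le_sum_abs _ _).trans (Finset.sum_le_sum fun k _ => ?_)
    have hb := hbdd (G (x + (k : ℕ)))
    have hl := hexp (G (x + (k : ℕ)))
    have hp := hpos (G (x + (k : ℕ)))
    generalize deriv (deriv F) (G (x + (k : ℕ))) = c at *
    generalize deriv F (G (x + (k : ℕ))) = d at *
    generalize ψ ↑(G (x + (k : ℕ))) = a at *
    generalize ψ' ↑(G (x + (k : ℕ))) = b at *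
    have hl0 : 0 < lam := by linarith
    have hn : 0 ≤ nT'' := (abs_nonneg c).trans hb
    have e1 : (b * d - a * c) / d ^ 2 * d⁻¹ = (1 / d) * (b / d) - (c / d ^ 2) * (a / d) := by
      field_simp
    rw [e1]
    refine (abs_sub _ _).trans ?_
    simp only [abs_mul, abs_div, abs_pow, abs_one, abs_of_pos hp]
    gcongr
end

section
/- For every bounded measurable ψ : S¹ → ℝ, sup_{n ∈ ℕ} ‖Lⁿψ‖_∞ ≤ (1 + Ω)·‖ψ‖_∞. -/
open MeasureTheory Real

theorem snb_sum_mul (a : ℕ → ℝ) (w m : ℕ) :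
    ∑ i ∈ Finset.range (m * w), a i
      = ∑ j ∈ Finset.range w, ∑ k ∈ Finset.range m, a (j + w * k) := by
  rw [Finset.sum_comm]
  induction m with
  | zero => simp
  | succ m ih =>
    rw [Finset.sum_range_succ, ← ih, Nat.succ_mul, Finset.sum_range_add]
    congr 1
    refine Finset.sum_congr rfl fun j _ => ?_
    congr 1
    ring

noncomputable def snbH (F : ℝ → ℝ) : ℕ → ℝ → ℝ
  | 0 => fun _ => 1
  | n + 1 => fun t => snbH F n t / deriv F (F^[n] t)

theorem snb_surj (F : ℝ → ℝ) (hF : Continuous F) (w : ℕ) (hw : 0 < w)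
    (hk : ∀ (k : ℤ) (x : ℝ), F (x + k) = F x + w * k) : Function.Surjective F := by
  intro y
  have hw1 : (1 : ℝ) ≤ w := by exact_mod_cast hw
  have h := mem_range_of_exists_le_of_exists_ge (c := y) hF ?_ ?_
  · exact h
  · obtain ⟨k, hk1⟩ := exists_nat_gt (|y - F 0|)
    refine ⟨0 + ((-(k : ℤ) : ℤ) : ℝ), ?_⟩
    rw [hk]
    push_cast
    have := neg_abs_le (y - F 0)
    nlinarith [abs_nonneg (y - F 0)]
  · obtain ⟨k, hk1⟩ := exists_nat_gt (|y - F 0|)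
    refine ⟨0 + ((k : ℤ) : ℝ), ?_⟩
    rw [hk]
    push_cast
    have := le_abs_self (y - F 0)
    nlinarith [abs_nonneg (y - F 0)]

theorem snb_shift (F : ℝ → ℝ) (w : ℕ) (hFw : ∀ x : ℝ, F (x + 1) = F x + w)
    (k : ℤ) (x : ℝ) : F (x + k) = F x + w * k := by
  have hn : ∀ (n : ℕ) (x : ℝ), F (x + n) = F x + w * n := by
    intro n
    induction n with
    | zero => simp
    | succ n ih =>
      intro x
      push_cast
      rw [← add_assoc, hFw, ih]
      ring
  obtain ⟨n, rfl | rfl⟩ := k.eq_nat_or_neg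
  · exact_mod_cast hn n x
  · have := hn n (x - n)
    push_cast
    rw [sub_add_cancel] at this
    rw [← sub_eq_add_neg]
    linarith

theorem snb_H (F : ℝ → ℝ) (hF : ContDiff ℝ 2 F) (lam M Om : ℝ) (hlam : 1 < lam)
    (hexp : ∀ x : ℝ, lam ≤ deriv F x) (hM : ∀ x, |deriv (deriv F) x| ≤ M)
    (hOm : Om = M / (lam * (lam - 1))) (n : ℕ) :
    ∀ t, 0 < snbH F n t ∧ HasDerivAt (F^[n]) (snbH F n t)⁻¹ t ∧
      ∃ d, HasDerivAt (snbH F n) d t ∧ |d| ≤ Om := by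
  have hM0 : 0 ≤ M := (abs_nonneg _).trans (hM 0)
  have hl1 : 0 < lam - 1 := by linarith
  have hl0 : 0 < lam := by linarith
  have hOm0 : 0 ≤ Om := by rw [hOm]; positivity
  have hd1 : ∀ t, HasDerivAt F (deriv F t) t := fun t =>
    ((hF.differentiable (by norm_num)) t).hasDerivAt
  have hd2 : ∀ t, HasDerivAt (deriv F) (deriv (deriv F) t) t := fun t => by
    have h : ContDiff ℝ 1 (deriv F) := by
      have h2 : ContDiff ℝ (1 + 1) F := by
        have : (1 + 1 : WithTop ℕ∞) = 2 := by norm_num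
        rw [this]; exact hF
      exact (contDiff_succ_iff_deriv.1 h2).2.2
    exact ((h.differentiable (by norm_num)) t).hasDerivAt
  induction n with
  | zero =>
    intro t
    refine ⟨by simp [snbH], by simpa [snbH] using hasDerivAt_id t, 0, ?_, by simpa using hOm0⟩
    exact hasDerivAt_const t 1
  | succ n ih =>
    intro t
    obtain ⟨h1, h2, d, h3, h4⟩ := ih t
    set s := F^[n] t with hs
    have hD : lam ≤ deriv F s := hexp s
    have hD0 : 0 < deriv F s := by linarith
    refine ⟨div_pos h1 hD0, ?_, ?_⟩
    · rw [Function.iterate_succ']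
      have := (hd1 s).comp t h2
      have e : (snbH F (n + 1) t)⁻¹ = deriv F s * (snbH F n t)⁻¹ := by
        change (snbH F n t / deriv F s)⁻¹ = _
        field_simp
      rw [e]
      exact this
    · refine ⟨_, h3.div ((hd2 s).comp t h2) hD0.ne', ?_⟩
      have e : (d * (deriv F ∘ F^[n]) t - snbH F n t * (deriv (deriv F) s * (snbH F n t)⁻¹))
          / (deriv F ∘ F^[n]) t ^ 2 = d / deriv F s - deriv (deriv F) s / (deriv F s)^2 := by
        simp only [Function.comp]
        rw [← hs]
        field_simp
      refine (le_of_eq (congrArg abs e)).trans ?_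
      refine (abs_sub _ _).trans ?_
      rw [abs_div, abs_div, abs_of_pos hD0, abs_of_pos (pow_pos hD0 2)]
      have a1 : |d| / deriv F s ≤ Om / lam := by gcongr
      have a2 : |deriv (deriv F) s| / deriv F s ^ 2 ≤ M / lam ^ 2 := by
        gcongr
        exact hM s
      have a3 : Om / lam + M / lam ^ 2 = Om := by
        rw [hOm]
        field_simp
        ring
      linarith

theorem snb_step (F : ℝ → ℝ) (w : ℕ) (hw : 0 < w)
    (hk : ∀ (k : ℤ) (x : ℝ), F (x + k) = F x + w * k)
    (f : ℝ → ℝ) (hfF : ∀ x, f (F x) = x) (hFf : ∀ x, F (f x) = x)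
    (T : UnitAddCircle → UnitAddCircle) (hT : ∀ x : ℝ, T ↑x = (↑(F x) : UnitAddCircle))
    (v : UnitAddCircle → ℝ) (x : ℝ) :
    ∑' y : (T ⁻¹' {(x : UnitAddCircle)}), v y
      = ∑ j ∈ Finset.range w, v (↑(f (x + j)) : UnitAddCircle) := by
  have hint : ∀ a b : ℝ, (a : UnitAddCircle) = b ↔ ∃ n : ℤ, b = a + n := by
    intro a b
    constructor
    · intro h
      obtain ⟨n, hn⟩ := (AddCircle.coe_eq_zero_iff (p := (1 : ℝ)) (x := b - a)).1 (by
        rw [AddCircle.coe_sub, h, sub_self])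
      exact ⟨n, by simp at hn; linarith⟩
    · rintro ⟨n, rfl⟩
      have h0 : ((n : ℝ) : UnitAddCircle) = 0 :=
        (AddCircle.coe_eq_zero_iff (p := (1 : ℝ)) (x := (n : ℝ))).2 ⟨n, by simp⟩
      rw [AddCircle.coe_add, h0, add_zero]
  have hmem : ∀ j : Fin w, (↑(f (x + (j : ℕ))) : UnitAddCircle) ∈
      T ⁻¹' {(x : UnitAddCircle)} := by
    intro j
    rw [Set.mem_preimage, hT, hFf, Set.mem_singleton_iff, eq_comm, hint]
    exact ⟨(j : ℕ), by push_cast; rfl⟩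
  let e : Fin w → (T ⁻¹' {(x : UnitAddCircle)}) := fun j => ⟨_, hmem j⟩
  have hbij : Function.Bijective e := by
    constructor
    · intro i j hij
      have h := congrArg Subtype.val hij
      obtain ⟨n, hn⟩ := (hint _ _).1 h
      have h2 := congrArg F hn
      rw [hFf, hk, hFf] at h2
      have h3 : ((j : ℕ) : ℤ) = (i : ℕ) + w * n := by
        have : ((j : ℕ) : ℝ) = (i : ℕ) + w * n := by linarith
        exact_mod_cast this
      have h4 : ((j : ℕ) : ℤ) % w = ((i : ℕ) : ℤ) % w := by
        rw [h3, Int.add_mul_emod_self_left]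
      have h5 : (j : ℕ) % w = (i : ℕ) % w := by exact_mod_cast h4
      rw [Nat.mod_eq_of_lt j.2, Nat.mod_eq_of_lt i.2] at h5
      exact Fin.ext h5.symm
    · rintro ⟨y, hy⟩
      obtain ⟨t, rfl⟩ := QuotientAddGroup.mk_surjective y
      have hy2 : T (t : UnitAddCircle) = x := hy
      rw [hT, eq_comm, hint] at hy2
      obtain ⟨m, hm⟩ := hy2
      have hwz : (0 : ℤ) < w := by exact_mod_cast hw
      have hr0 := Int.emod_nonneg m hwz.ne'
      have hr1 := Int.emod_lt_of_pos m hwz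
      have hdm := Int.emod_add_mul_ediv m w
      refine ⟨⟨(m % w).toNat, by omega⟩, Subtype.ext ?_⟩
      change ((f (x + ((m % w).toNat : ℝ)) : ℝ) : UnitAddCircle) = (t : UnitAddCircle)
      rw [hint]
      refine ⟨m / w, ?_⟩
      rw [← hfF t, ← hfF (f _ + _), hk, hFf, hm]
      congr 1
      have hc : (((m % w).toNat : ℤ) : ℝ) = ((m % w : ℤ) : ℝ) := by
        rw [Int.toNat_of_nonneg hr0]
      rw [Int.cast_natCast] at hc
      rw [hc]
      have : (m : ℝ) = ((m % w + w * (m / w) : ℤ) : ℝ) := by rw [hdm]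
      rw [this]
      push_cast
      ring
  rw [← (Equiv.ofBijective e hbij).tsum_eq, tsum_fintype, Finset.sum_range]
  rfl

theorem sup_norm_bound
    (F : ℝ → ℝ) (hF : ContDiff ℝ 2 F)
    (w : ℕ) (hw : 0 < w) (hFw : ∀ x : ℝ, F (x + 1) = F x + w)
    (T : UnitAddCircle → UnitAddCircle) (hT : ∀ x : ℝ, T ↑x = (↑(F x) : UnitAddCircle))
    (lam : ℝ) (hlam : 1 < lam) (hexp : ∀ x : ℝ, lam ≤ deriv F x)
    (nT'' : ℝ) (hnT'' : nT'' = ⨆ x : ℝ, |deriv (deriv F) x|)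
    (Omega : ℝ) (hOmega : Omega = nT'' / (lam * (lam - 1)))
    (T' : UnitAddCircle → ℝ) (hT'lift : ∀ x : ℝ, T' ↑x = deriv F x)
    (L : (UnitAddCircle → ℝ) → (UnitAddCircle → ℝ))
    (hL : ∀ u : UnitAddCircle → ℝ, ∀ x : UnitAddCircle,
      L u x = ∑' y : (T ⁻¹' {x}), u y / T' y)
    (ψ : UnitAddCircle → ℝ) (hmeas : Measurable ψ) (C : ℝ) (hC : ∀ x, |ψ x| ≤ C) :
    ∀ n : ℕ, ∀ x, |(L^[n] ψ) x| ≤ (1 + Omega) * C := by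
  have hk := snb_shift F w hFw
  have hC0 : 0 ≤ C := (abs_nonneg _).trans (hC 0)
  have hcont : Continuous F := hF.continuous
  have hmono : StrictMono F := strictMono_of_deriv_pos fun x => by linarith [hexp x]
  have hsurj := snb_surj F hcont w hw hk
  obtain ⟨f, hFf⟩ := hsurj.hasRightInverse
  have hFf : ∀ x, F (f x) = x := hFf
  have hfF : ∀ x, f (F x) = x := fun x => hmono.injective (hFf _)
  have hfmono : StrictMono f := fun a b hab => by
    rw [← hmono.lt_iff_lt, hFf, hFf]; exact hab
  have hfk : ∀ (k : ℤ) (x : ℝ), f (x + w * k) = f x + k := fun k x => by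
    apply hmono.injective
    rw [hFf, hk, hFf]
  have hdper : Function.Periodic (deriv F) 1 := by
    intro x
    have h : (fun y => F (y + 1)) = fun y => F y + w := funext hFw
    have := congrArg (fun g => deriv g x) h
    simpa [deriv_comp_add_const] using this
  have hddper : Function.Periodic (deriv (deriv F)) 1 := by
    intro x
    have h : (fun y => deriv F (y + 1)) = fun y => deriv F y := funext hdper
    have := congrArg (fun g => deriv g x) h
    simpa [deriv_comp_add_const] using this
  have hddc : Continuous (deriv (deriv F)) := by
    have := hF.continuous_iteratedDeriv 2 le_rfl
    simpa [iteratedDeriv_succ, iteratedDeriv_zero] using this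
  have hM : ∀ x, |deriv (deriv F) x| ≤ nT'' := by
    intro x
    rw [hnT'']
    refine le_ciSup (f := fun x => |deriv (deriv F) x|) ?_ x
    have hp : Function.Periodic (fun x => |deriv (deriv F) x|) 1 := fun x => by
      simp only [hddper x]
    exact (hp.compact_of_continuous one_ne_zero hddc.abs).bddAbove
  have hH := snb_H F hF lam nT'' Omega hlam hexp hM hOmega
  have hOm0 : 0 ≤ Omega := by
    obtain ⟨-, -, d, -, h⟩ := hH 0 0
    exact (abs_nonneg d).trans h
  have hFfn : ∀ n x, F^[n] (f^[n] x) = x := fun n =>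
    (Function.LeftInverse.iterate (f := f) (g := F) hFf n)
  have hform : ∀ n, ∀ x : ℝ, (L^[n] ψ) (x : UnitAddCircle) = ∑ i ∈ Finset.range (w ^ n),
      ψ (↑(f^[n] (x + i)) : UnitAddCircle) * snbH F n (f^[n] (x + i)) := by
    intro n
    induction n with
    | zero => intro x; simp [snbH]
    | succ n ih =>
      intro x
      rw [Function.iterate_succ_apply', hL,
        snb_step F w hw hk f hfF hFf T hT (fun y => (L^[n] ψ) y / T' y) x, pow_succ, snb_sum_mul]
      refine Finset.sum_congr rfl fun j _ => ?_
      rw [ih, hT'lift, Finset.sum_div]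
      refine Finset.sum_congr rfl fun k _ => ?_
      have e : f (x + j) + k = f (x + ((j + w * k : ℕ) : ℝ)) := by
        have := hfk k (x + j)
        push_cast at this ⊢
        rw [← this]
        congr 1
        ring
      have e2 : deriv F (f (x + j)) = deriv F (f (x + ((j + w * k : ℕ) : ℝ))) := by
        rw [← e]
        have := (hdper.nat_mul k) (f (x + j))
        rw [mul_one] at this
        exact this.symm
      rw [e, e2, Function.iterate_succ_apply]
      simp only [snbH]
      rw [hFfn, mul_div_assoc]
  have hper : ∀ n, ∀ x : ℝ, f^[n] (x + ((w ^ n : ℕ) : ℝ)) = f^[n] x + 1 := by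
    intro n
    induction n with
    | zero => intro x; simp
    | succ n ih =>
      intro x
      rw [Function.iterate_succ_apply, Function.iterate_succ_apply, ← ih]
      congr 1
      have := hfk ((w ^ n : ℕ) : ℤ) x
      push_cast at this ⊢
      rw [← this]
      congr 1
      ring
  intro n x
  obtain ⟨x, rfl⟩ := QuotientAddGroup.mk_surjective x
  change |(L^[n] ψ) (x : UnitAddCircle)| ≤ _
  rw [hform]
  have hfnmono : StrictMono (f^[n]) := hfmono.iterate n
  have key : ∀ i : ℕ, snbH F n (f^[n] (x + i)) ≤
      (1 + Omega) * (f^[n] (x + ((i + 1 : ℕ) : ℝ)) - f^[n] (x + i)) := by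
    intro i
    set a := f^[n] (x + i) with ha
    set b := f^[n] (x + ((i + 1 : ℕ) : ℝ)) with hb
    have hab : a < b := hfnmono (by push_cast; linarith)
    have hd : ∀ t, HasDerivAt (F^[n]) (snbH F n t)⁻¹ t := fun t => (hH n t).2.1
    obtain ⟨ξ, hξ, hξ2⟩ := exists_hasDerivAt_eq_slope (F^[n]) (fun t => (snbH F n t)⁻¹) hab
      (fun t _ => (hd t).continuousAt.continuousWithinAt) (fun t _ => hd t)
    have hnum : F^[n] b - F^[n] a = 1 := by
      rw [ha, hb, hFfn, hFfn]; push_cast; ring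
    rw [hnum] at hξ2
    have hξ3 : snbH F n ξ = b - a := by
      have := congrArg (fun z => z⁻¹) hξ2
      simpa using this
    have hlip : ‖snbH F n a - snbH F n ξ‖ ≤ Omega * ‖a - ξ‖ := by
      refine Convex.norm_image_sub_le_of_norm_deriv_le (s := Set.univ) (fun t _ => ?_)
        (fun t _ => ?_) convex_univ trivial trivial
      · obtain ⟨-, -, d, h, -⟩ := hH n t
        exact h.differentiableAt
      · obtain ⟨-, -, d, h, h'⟩ := hH n t
        rw [h.deriv]; exact h'
    rw [Real.norm_eq_abs, Real.norm_eq_abs, abs_of_neg (by linarith [hξ.1] : a - ξ < 0)] at hlip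
    have := le_abs_self (snbH F n a - snbH F n ξ)
    nlinarith [hξ.1, hξ.2]
  calc _ ≤ ∑ i ∈ Finset.range (w ^ n),
      |ψ (↑(f^[n] (x + i)) : UnitAddCircle) * snbH F n (f^[n] (x + i))| :=
        Finset.abs_sum_le_sum_abs _ _
    _ ≤ ∑ i ∈ Finset.range (w ^ n), C * ((1 + Omega) *
          (f^[n] (x + ((i + 1 : ℕ) : ℝ)) - f^[n] (x + i))) := by
        refine Finset.sum_le_sum fun i _ => ?_
        have hp := (hH n (f^[n] (x + i))).1
        rw [abs_mul, abs_of_pos hp]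
        exact mul_le_mul (hC _) (key i) hp.le hC0
    _ = (1 + Omega) * C := by
        rw [← Finset.mul_sum, ← Finset.mul_sum,
          Finset.sum_range_sub (fun i : ℕ => f^[n] (x + (i : ℝ))), hper]
        simp
        ring
end

section
/- There exists a T-invariant Borel probability measure μ on S¹ (i.e. μ(T⁻¹A) = μ(A) for every Borel set A) that is absolutely continuous with respect to m and whose density φ = dμ/dm is Lipschitz continuous with Lipschitz constant Lip(φ) ≤ (1 + Ω)². -/
open MeasureTheory Real

def InP (Ω : ℝ) (f : UnitAddCircle → ℝ) : Prop :=
  Continuous f ∧ (∀ x, 0 ≤ f x) ∧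
  (∀ x y : ℝ, f (x : UnitAddCircle) ≤ f (y : UnitAddCircle) * exp (Ω * |x - y|)) ∧
  ∫ x, f x = 1

lemma exists_reps (a b : UnitAddCircle) :
    ∃ x y : ℝ, (x : UnitAddCircle) = a ∧ (y : UnitAddCircle) = b ∧ |x - y| = dist a b := by
  obtain ⟨x, rfl⟩ := QuotientAddGroup.mk_surjective a
  obtain ⟨y, rfl⟩ := QuotientAddGroup.mk_surjective b
  refine ⟨x - round (x - y), y, ?_, rfl, ?_⟩
  · have : ((x - (round (x - y) : ℝ) : ℝ) : UnitAddCircle) = (x : UnitAddCircle) := by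
      refine QuotientAddGroup.eq.2 ?_
      exact ⟨round (x - y), by simp⟩
    exact this
  · rw [dist_eq_norm]
    have : ‖((x - y : ℝ) : UnitAddCircle)‖ = |(x - y) - round (x - y)| := UnitAddCircle.norm_eq
    rw [show (x - (round (x - y) : ℝ) - y) = (x - y) - round (x - y) by ring, ← this]
    rfl

lemma InP.bound {Ω : ℝ} (hΩ : 0 ≤ Ω) {f : UnitAddCircle → ℝ} (h : InP Ω f) (x : ℝ) :
    f x * (1 - exp (-Ω)) ≤ Ω := by
  obtain ⟨hc, h0, hcone, hint⟩ := h
  have hcl : Continuous (fun t : ℝ => f (t : UnitAddCircle)) :=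
    hc.comp (AddCircle.continuous_mk' 1)
  have h1 : ∫ t in x..x+1, f (t : UnitAddCircle) = 1 :=
    (UnitAddCircle.intervalIntegral_preimage x f).trans hint
  have h2 : ∫ t in x..x+1, f x * (Ω * exp (-(Ω * (t - x)))) = f x * (1 - exp (-Ω)) := by
    rw [intervalIntegral.integral_eq_sub_of_hasDerivAt
      (f := fun t => - (f x * exp (-(Ω * (t - x)))))]
    · simp; ring
    · intro t _
      have : HasDerivAt (fun t : ℝ => -(Ω * (t - x))) (-(Ω * 1)) t :=
        (((hasDerivAt_id t).sub_const x).const_mul Ω).neg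
      have := ((this.exp).const_mul (f x)).neg
      refine this.congr_deriv ?_
      ring
    · apply Continuous.intervalIntegrable; fun_prop
  have h3 : ∫ t in x..x+1, Ω * f (t : UnitAddCircle) = Ω := by
    rw [intervalIntegral.integral_const_mul, h1, mul_one]
  rw [← h2]
  refine le_trans ?_ h3.le
  apply intervalIntegral.integral_mono_on (by linarith)
  · apply Continuous.intervalIntegrable; fun_prop
  · apply Continuous.intervalIntegrable; fun_prop
  · intro t ht
    have := hcone x t
    rw [abs_sub_comm, abs_of_nonneg (by linarith [ht.1])] at this
    have h4 : f x * exp (-(Ω * (t - x))) ≤ f t := by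
      rw [exp_neg, ← div_eq_mul_inv, div_le_iff₀ (exp_pos _)]; exact this
    nlinarith [mul_le_mul_of_nonneg_left h4 hΩ]

lemma InP.bound2 {Ω : ℝ} (hΩ : 0 ≤ Ω) {f : UnitAddCircle → ℝ} (h : InP Ω f) (x : ℝ) :
    f x ≤ exp Ω := by
  obtain ⟨hc, h0, hcone, hint⟩ := h
  have hcl : Continuous (fun t : ℝ => f (t : UnitAddCircle)) :=
    hc.comp (AddCircle.continuous_mk' 1)
  have h1 : ∫ t in x..x+1, f (t : UnitAddCircle) = 1 :=
    (UnitAddCircle.intervalIntegral_preimage x f).trans hint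
  have h2 : ∫ t in x..x+1, f x = f x := by simp
  have h3 : ∫ t in x..x+1, f (t : UnitAddCircle) * exp Ω = exp Ω := by
    rw [intervalIntegral.integral_mul_const, h1, one_mul]
  rw [← h2]
  refine le_trans ?_ h3.le
  apply intervalIntegral.integral_mono_on (by linarith)
  · apply Continuous.intervalIntegrable; fun_prop
  · apply Continuous.intervalIntegrable; fun_prop
  · intro t ht
    refine (hcone x t).trans ?_
    gcongr
    · exact h0 _
    · rw [abs_sub_comm, abs_of_nonneg (by linarith [ht.1])]
      nlinarith [ht.2]

lemma InP.lip {Ω : ℝ} (hΩ : 0 ≤ Ω) {f : UnitAddCircle → ℝ} (h : InP Ω f) :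
    LipschitzWith ((1 + Ω) ^ 2).toNNReal f := by
  have hM : ∀ x : ℝ, f x * Ω ≤ (1 + Ω) ^ 2 := by
    intro x
    have h1 := h.bound hΩ x
    have h0 := h.2.1 x
    have h2 : Ω ≤ (1 + Ω) * (1 - exp (-Ω)) := by
      have h3 := add_one_le_exp Ω
      have h4 : exp Ω * exp (-Ω) = 1 := by rw [← exp_add]; simp
      nlinarith [mul_le_mul_of_nonneg_right h3 (exp_pos (-Ω)).le]
    nlinarith [mul_le_mul_of_nonneg_left h2 h0,
      mul_le_mul_of_nonneg_left h1 (by linarith : 0 ≤ 1 + Ω)]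
  have key : ∀ x y : ℝ, f x - f y ≤ (1 + Ω) ^ 2 * |x - y| := by
    intro x y
    have h1 := h.2.2.1 x y
    have h0 := h.2.1 x
    have h3 := add_one_le_exp (-(Ω * |x - y|))
    have h2 : f x * exp (-(Ω * |x - y|)) ≤ f y := by
      rw [exp_neg, ← div_eq_mul_inv, div_le_iff₀ (exp_pos _)]; exact h1
    nlinarith [mul_le_mul_of_nonneg_left h3 h0,
      mul_le_mul_of_nonneg_right (hM x) (abs_nonneg (x - y))]
  apply LipschitzWith.of_dist_le_mul
  intro a b
  obtain ⟨x, y, rfl, rfl, hd⟩ := exists_reps a b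
  rw [← hd, Real.coe_toNNReal _ (by positivity), Real.dist_eq, abs_le]
  constructor
  · have := key y x
    rw [abs_sub_comm] at this; linarith
  · exact key x y

/-- compactness -/
lemma InP.compact {Ω : ℝ} (hΩ : 0 ≤ Ω) (a : ℕ → UnitAddCircle → ℝ) (ha : ∀ n, InP Ω (a n)) :
    ∃ φ : UnitAddCircle → ℝ, ∃ s : ℕ → ℕ, StrictMono s ∧ InP Ω φ ∧
      ∀ x, Filter.Tendsto (fun n => a (s n) x) Filter.atTop (nhds (φ x)) := by
  let b : ℕ → BoundedContinuousFunction UnitAddCircle ℝ :=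
    fun n => BoundedContinuousFunction.mkOfCompact ⟨a n, (ha n).1⟩
  have hb2 : ∀ n x, a n x ≤ exp Ω := by
    intro n x
    obtain ⟨x, rfl⟩ := QuotientAddGroup.mk_surjective x
    exact (ha n).bound2 hΩ x
  have hK : IsCompact (closure (Set.range b)) := by
    apply BoundedContinuousFunction.arzela_ascoli (Set.Icc 0 (exp Ω)) isCompact_Icc
    · rintro f x ⟨n, rfl⟩
      exact ⟨(ha n).2.1 x, hb2 n x⟩
    · apply UniformEquicontinuous.equicontinuous
      apply LipschitzWith.uniformEquicontinuous _ ((1 + Ω) ^ 2).toNNReal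
      rintro ⟨f, n, rfl⟩
      exact (ha n).lip hΩ
  obtain ⟨φ, -, s, hs, hlim⟩ := hK.tendsto_subseq (fun n => subset_closure (Set.mem_range_self n))
  have hpt : ∀ x, Filter.Tendsto (fun n => a (s n) x) Filter.atTop (nhds (φ x)) := by
    intro x
    have hx : Continuous (fun f : BoundedContinuousFunction UnitAddCircle ℝ => f x) := by fun_prop
    exact (hx.tendsto φ).comp hlim
  refine ⟨φ, s, hs, ⟨φ.continuous, ?_, ?_, ?_⟩, hpt⟩
  · intro x
    exact ge_of_tendsto' (hpt x) (fun n => (ha _).2.1 x)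
  · intro x y
    exact le_of_tendsto_of_tendsto' (hpt x) ((hpt y).mul_const _) (fun n => (ha _).2.2.1 x y)
  · have := tendsto_integral_of_dominated_convergence (μ := (volume : Measure UnitAddCircle))
      (F := fun n => a (s n)) (f := φ) (fun _ => exp Ω)
      (fun n => (ha _).1.aestronglyMeasurable) (integrable_const _)
      (fun n => Filter.Eventually.of_forall fun x => by
        rw [Real.norm_of_nonneg ((ha _).2.1 x)]; exact hb2 _ x)
      (Filter.Eventually.of_forall hpt)
    simp only [(ha _).2.2.2] at this
    exact tendsto_nhds_unique this tendsto_const_nhds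

lemma InP.avg {Ω : ℝ} (a : ℕ → UnitAddCircle → ℝ) (ha : ∀ n, InP Ω (a n)) (n : ℕ) :
    InP Ω (fun x => ((n : ℝ) + 1)⁻¹ * ∑ k ∈ Finset.range (n + 1), a k x) := by
  have hp : (0 : ℝ) ≤ ((n : ℝ) + 1)⁻¹ := by positivity
  refine ⟨?_, ?_, ?_, ?_⟩
  · exact continuous_const.mul (continuous_finsetSum _ fun k _ => (ha k).1)
  · intro x
    exact mul_nonneg hp (Finset.sum_nonneg fun k _ => (ha k).2.1 x)
  · intro x y
    rw [mul_assoc, Finset.sum_mul]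
    exact mul_le_mul_of_nonneg_left (Finset.sum_le_sum fun k _ => (ha k).2.2.1 x y) hp
  · rw [integral_const_mul, integral_finsetSum]
    · simp only [(ha _).2.2.2]
      simp
      field_simp
    · intro k _
      exact (ha k).1.integrable_of_hasCompactSupport (HasCompactSupport.of_compactSpace _)

lemma lint_sum (q : ℝ → ENNReal) (hq : Measurable q) (a : ℝ) (n : ℕ) :
    ∫⁻ x in Set.Ioc a (a + n), q x
      = ∫⁻ x in Set.Ioc a (a + 1), ∑ k ∈ Finset.range n, q (x + k) := by
  induction n with
  | zero => simp
  | succ n ih =>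
    simp_rw [Finset.sum_range_succ]
    rw [lintegral_add_right _ (by fun_prop), ← ih]
    have : Set.Ioc a (a + (n + 1 : ℕ)) = Set.Ioc a (a + n) ∪ Set.Ioc (a + n) (a + n + 1) := by
      rw [Set.Ioc_union_Ioc_eq_Ioc (by simp) (by simp)]
      push_cast; rw [add_assoc]
    rw [this, lintegral_union measurableSet_Ioc (by
      rw [Set.disjoint_left]; intro x hx hx'; exact absurd hx.2 (not_le.2 hx'.1))]
    congr 1
    rw [← lintegral_indicator measurableSet_Ioc, ← lintegral_indicator measurableSet_Ioc,
      ← lintegral_add_right_eq_self _ (n : ℝ)]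
    congr 1
    ext x
    simp only [Set.indicator, Set.mem_Ioc]
    have : (a + n < x + n ∧ x + n ≤ a + n + 1) ↔ (a < x ∧ x ≤ a + 1) := by
      constructor <;> rintro ⟨h1, h2⟩ <;> constructor <;> linarith
    simp only [this]

lemma circ_cont {Y : Type*} [TopologicalSpace Y] (f : UnitAddCircle → Y)
    (h : Continuous (fun x : ℝ => f (x : UnitAddCircle))) : Continuous f :=
  (QuotientAddGroup.isQuotientMap_mk (N := AddSubgroup.zmultiples (1 : ℝ))).continuous_iff.2 h

/-- duality -/
lemma duality (F : ℝ → ℝ) (hFd : Differentiable ℝ F) (w : ℕ)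
    (hFw : ∀ x : ℝ, F (x + 1) = F x + w) (hFm : StrictMono F)
    (T : UnitAddCircle → UnitAddCircle) (hT : ∀ x : ℝ, T ↑x = (↑(F x) : UnitAddCircle))
    (G : ℝ → ℝ) (hGF : ∀ x, G (F x) = x) (hFG : ∀ x, F (G x) = x) (hGc : Continuous G)
    (hpos : ∀ x, 0 < deriv F x) (hF'c : Continuous (deriv F))
    (f : UnitAddCircle → ℝ) (hf : Continuous f) (hf0 : ∀ x, 0 ≤ f x)
    (Lf : UnitAddCircle → ℝ) (hLf : ∀ x : ℝ, Lf (x : UnitAddCircle) =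
      ∑ k ∈ Finset.range w, f (G (x + k) : ℝ) * (deriv F (G (x + k)))⁻¹)
    (h : UnitAddCircle → ENNReal) (hh : Measurable h) :
    ∫⁻ x, h (T x) * ENNReal.ofReal (f x) = ∫⁻ x, h x * ENNReal.ofReal (Lf x) := by
  have hcoe : Continuous (fun x : ℝ => (x : UnitAddCircle)) := AddCircle.continuous_mk' 1
  let q : ℝ → ENNReal := fun x =>
    h (x : UnitAddCircle) * ENNReal.ofReal (f (G x : ℝ) * (deriv F (G x))⁻¹)
  have hcont : Continuous (fun x : ℝ => f (G x : ℝ) * (deriv F (G x))⁻¹) :=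
    (hf.comp (hcoe.comp hGc)).mul ((hF'c.comp hGc).inv₀ fun x => (hpos _).ne')
  have hq : Measurable q :=
    (hh.comp hcoe.measurable).mul (ENNReal.measurable_ofReal.comp hcont.measurable)
  have himg : F '' Set.Ioc 0 1 = Set.Ioc (F 0) (F 0 + w) := by
    have h1 : F 1 = F 0 + w := by simpa using hFw 0
    ext x
    constructor
    · rintro ⟨t, ht, rfl⟩
      exact ⟨hFm ht.1, by rw [← h1]; exact hFm.monotone ht.2⟩
    · rintro ⟨h2, h3⟩
      refine ⟨G x, ⟨?_, ?_⟩, hFG x⟩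
      · rw [← hFm.lt_iff_lt, hFG]; exact h2
      · rw [← hFm.le_iff_le, hFG, h1]; exact h3
  calc ∫⁻ x, h (T x) * ENNReal.ofReal (f x)
      = ∫⁻ t in Set.Ioc (0:ℝ) (0 + 1), h (T t) * ENNReal.ofReal (f t) :=
        (UnitAddCircle.lintegral_preimage 0 (fun x => h (T x) * ENNReal.ofReal (f x))).symm
    _ = ∫⁻ t in Set.Ioc (0:ℝ) 1, ENNReal.ofReal |deriv F t| * q (F t) := by
        rw [zero_add]
        refine lintegral_congr fun t => ?_
        simp only [q]
        rw [hT, hGF, abs_of_pos (hpos t), mul_left_comm, ← ENNReal.ofReal_mul (hpos t).le]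
        congr 2
        field_simp [(hpos t).ne']
    _ = ∫⁻ x in F '' Set.Ioc (0:ℝ) 1, q x :=
        (lintegral_image_eq_lintegral_abs_deriv_mul measurableSet_Ioc
          (fun x _ => (hFd x).hasDerivAt.hasDerivWithinAt) hFm.injective.injOn q).symm
    _ = ∫⁻ x in Set.Ioc (F 0) (F 0 + 1), ∑ k ∈ Finset.range w, q (x + k) := by
        rw [himg, lint_sum q hq]
    _ = ∫⁻ x in Set.Ioc (F 0) (F 0 + 1), h (x : UnitAddCircle) * ENNReal.ofReal (Lf x) := by
        refine lintegral_congr fun x => ?_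
        rw [hLf, ENNReal.ofReal_sum_of_nonneg, Finset.mul_sum]
        · refine Finset.sum_congr rfl fun k _ => ?_
          simp only [q]
          congr 2
          refine QuotientAddGroup.eq.2 ⟨-k, by simp⟩
        · intro k _
          exact mul_nonneg (hf0 _) (inv_nonneg.2 (hpos _).le)
    _ = ∫⁻ x, h x * ENNReal.ofReal (Lf x) :=
        UnitAddCircle.lintegral_preimage (F 0) (fun x => h x * ENNReal.ofReal (Lf x))

lemma circ_int (f : UnitAddCircle → ℝ) (hf : Continuous f) : Integrable f :=
  hf.integrable_of_hasCompactSupport (HasCompactSupport.of_compactSpace _)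

theorem exists_acim_lipschitz_density
    (F : ℝ → ℝ) (hF : ContDiff ℝ 2 F)
    (w : ℕ) (hw : 0 < w) (hFw : ∀ x : ℝ, F (x + 1) = F x + w)
    (T : UnitAddCircle → UnitAddCircle) (hT : ∀ x : ℝ, T ↑x = (↑(F x) : UnitAddCircle))
    (lam : ℝ) (hlam : 1 < lam) (hexp : ∀ x : ℝ, lam ≤ deriv F x)
    (nT'' : ℝ) (hnT'' : nT'' = ⨆ x : ℝ, |deriv (deriv F) x|)
    (Omega : ℝ) (hOmega : Omega = nT'' / (lam * (lam - 1))) :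
    ∃ (μ : Measure UnitAddCircle) (φ : UnitAddCircle → ℝ),
      IsProbabilityMeasure μ ∧
      (∀ A : Set UnitAddCircle, MeasurableSet A → μ (T ⁻¹' A) = μ A) ∧
      μ = volume.withDensity (fun x => ENNReal.ofReal (φ x)) ∧
      (∀ x, 0 ≤ φ x) ∧
      LipschitzWith ((1 + Omega) ^ 2).toNNReal φ := by
  have hlam0 : 0 < lam := by linarith
  have hFd : Differentiable ℝ F := hF.differentiable (by norm_num)
  have hF1 : ContDiff ℝ 1 (deriv F) := ((contDiff_succ_iff_deriv (n := 1)).1 hF).2.2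
  have hF'd : Differentiable ℝ (deriv F) := hF1.differentiable (by norm_num)
  have hF'c : Continuous (deriv F) := hF'd.continuous
  have hF''c : Continuous (deriv (deriv F)) := hF1.continuous_deriv (by norm_num)
  have hpos : ∀ x, 0 < deriv F x := fun x => hlam0.trans_le (hexp x)
  have hFm : StrictMono F := strictMono_of_deriv_pos hpos
  have hp1 : ∀ x, deriv F (x + 1) = deriv F x := by
    intro x
    rw [← deriv_comp_add_const, show (fun x => F (x + 1)) = fun x => F x + w from funext hFw]
    simp
  have hp2 : ∀ x, deriv (deriv F) (x + 1) = deriv (deriv F) x := by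
    intro x
    rw [← deriv_comp_add_const, show (fun x => deriv F (x + 1)) = deriv F from funext hp1]
  -- bound on second derivative
  have hN : ∀ x, |deriv (deriv F) x| ≤ nT'' := by
    intro x
    rw [hnT'']
    refine le_ciSup (f := fun x => |deriv (deriv F) x|) ?_ x
    obtain ⟨C, hC⟩ := (isCompact_Icc (a := (0:ℝ)) (b := 1)).exists_bound_of_continuousOn
      hF''c.continuousOn
    refine ⟨C, ?_⟩
    rintro _ ⟨y, rfl⟩
    obtain ⟨z, hz, hzy⟩ := Function.Periodic.exists_mem_Ico₀ (f := deriv (deriv F)) hp2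
      one_pos y
    simp only [hzy]
    exact hC z ⟨hz.1, hz.2.le⟩
  have hN0 : 0 ≤ nT'' := (abs_nonneg _).trans (hN 0)
  have hlam1 : 0 < lam - 1 := by linarith
  have hΩ : 0 ≤ Omega := by rw [hOmega]; positivity
  -- inverse
  have hexpand : ∀ x y, x ≤ y → lam * (y - x) ≤ F y - F x :=
    fun x y hxy => mul_sub_le_image_sub_of_le_deriv hFd hexp hxy
  have hsurj : Function.Surjective F := by
    apply hFd.continuous.surjective
    · refine Filter.tendsto_atTop_mono' _ (f₁ := fun y => lam * y + F 0) ?_ ?_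
      · filter_upwards [Filter.eventually_ge_atTop 0] with y hy
        have := hexpand 0 y hy
        linarith
      · exact Filter.tendsto_atTop_add_const_right _ _
          (Filter.tendsto_id.const_mul_atTop hlam0)
    · refine Filter.tendsto_atBot_mono' (f₁ := fun y => lam * y + F 0) _ ?_ ?_
      · filter_upwards [Filter.eventually_le_atBot 0] with y hy
        have := hexpand y 0 hy
        linarith
      · exact Filter.tendsto_atBot_add_const_right _ _
          (Filter.tendsto_id.const_mul_atBot hlam0)
  obtain ⟨G, hFG⟩ : ∃ G : ℝ → ℝ, ∀ x, F (G x) = x := ⟨_, Function.surjInv_eq hsurj⟩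
  have hGF : ∀ x, G (F x) = x := fun x => hFm.injective (hFG _)
  have hGlip : ∀ x y, |G x - G y| ≤ |x - y| / lam := by
    have key : ∀ u v, lam * |u - v| ≤ |F u - F v| := by
      intro u v
      rcases le_total u v with h | h
      · rw [abs_sub_comm, abs_of_nonneg (sub_nonneg.2 h), abs_sub_comm]
        exact (hexpand u v h).trans (le_abs_self _)
      · rw [abs_of_nonneg (sub_nonneg.2 h)]
        exact (hexpand v u h).trans (le_abs_self _)
    intro x y
    have := key (G x) (G y)
    rw [hFG, hFG] at this
    rw [le_div_iff₀ hlam0]; linarith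
  have hGc : Continuous G := by
    refine (LipschitzWith.of_dist_le_mul (K := (1 / lam).toNNReal) fun x y => ?_).continuous
    rw [Real.dist_eq, Real.dist_eq, Real.coe_toNNReal _ (by positivity)]
    refine (hGlip x y).trans (le_of_eq ?_)
    ring
  have hGw : ∀ x, G (x + w) = G x + 1 := by
    intro x
    apply hFm.injective
    rw [hFG, hFw, hFG]
  -- distortion
  have hdist : ∀ x y, (deriv F (G x))⁻¹ ≤
      (deriv F (G y))⁻¹ * exp (nT'' / lam ^ 2 * |x - y|) := by
    intro x y
    have hlog : |log (deriv F (G y)) - log (deriv F (G x))| ≤ nT'' / lam * |G y - G x| := by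
      have := Convex.norm_image_sub_le_of_norm_deriv_le (f := fun t => log (deriv F t))
        (s := Set.univ) (C := nT'' / lam) (x := G x) (y := G y)
        (fun t _ => (hF'd t).log (hpos t).ne') (fun t _ => ?_) convex_univ trivial trivial
      · simpa using this
      · rw [deriv.log (hF'd t) (hpos t).ne', norm_div, Real.norm_eq_abs, Real.norm_eq_abs,
          abs_of_pos (hpos t)]
        exact div_le_div₀ hN0 (hN t) hlam0 (hexp t)
    have h2 : log (deriv F (G y)) - log (deriv F (G x)) ≤ nT'' / lam ^ 2 * |x - y| := by
      refine (le_abs_self _).trans (hlog.trans ?_)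
      have h3 := mul_le_mul_of_nonneg_left (hGlip y x) (div_nonneg hN0 hlam0.le)
      refine h3.trans (le_of_eq ?_)
      rw [abs_sub_comm y x]
      field_simp
    have h4 : deriv F (G y) ≤ deriv F (G x) * exp (nT'' / lam ^ 2 * |x - y|) := by
      rw [← exp_log (hpos (G y)), ← exp_log (hpos (G x)), ← exp_add]
      exact exp_le_exp.2 (by linarith)
    have hx := hpos (G x)
    have hy := hpos (G y)
    rw [inv_mul_eq_div, inv_eq_one_div, div_le_div_iff₀ hx hy]
    linarith
  -- operator
  have hper : ∀ f : UnitAddCircle → ℝ, Function.Periodic (fun x : ℝ =>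
      ∑ k ∈ Finset.range w, f (G (x + k) : ℝ) * (deriv F (G (x + k)))⁻¹) 1 := by
    intro f x
    have hs := Finset.sum_range_succ
      (fun k : ℕ => f (G (x + k) : ℝ) * (deriv F (G (x + k)))⁻¹) w
    have hs' := Finset.sum_range_succ'
      (fun k : ℕ => f (G (x + k) : ℝ) * (deriv F (G (x + k)))⁻¹) w
    have he : f (G (x + w) : ℝ) * (deriv F (G (x + w)))⁻¹ =
        f (G (x + (0 : ℕ)) : ℝ) * (deriv F (G (x + (0 : ℕ))))⁻¹ := by
      rw [hGw, hp1, Nat.cast_zero, add_zero]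
      congr 2
      exact QuotientAddGroup.eq.2 ⟨-1, by simp⟩
    rw [hs', he] at hs
    have hs2 := add_right_cancel hs
    simp only
    rw [← hs2]
    refine Finset.sum_congr rfl fun k _ => ?_
    rw [show x + ((k + 1 : ℕ) : ℝ) = x + 1 + k by push_cast; ring]
  obtain ⟨L, hL⟩ : ∃ L : (UnitAddCircle → ℝ) → UnitAddCircle → ℝ, ∀ f (x : ℝ),
      L f (x : UnitAddCircle) =
        ∑ k ∈ Finset.range w, f (G (x + k) : ℝ) * (deriv F (G (x + k)))⁻¹ :=
    ⟨fun f => (hper f).lift, fun f x => (hper f).lift_coe x⟩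
  have hcoe : Continuous (fun x : ℝ => (x : UnitAddCircle)) := AddCircle.continuous_mk' 1
  have hLc : ∀ f, Continuous f → Continuous (L f) := by
    intro f hf
    apply circ_cont
    simp only [hL]
    refine continuous_finsetSum _ fun k _ => ?_
    have h1 : Continuous (fun x : ℝ => G (x + k)) := hGc.comp (by fun_prop)
    exact (hf.comp (hcoe.comp h1)).mul ((hF'c.comp h1).inv₀ fun x => (hpos _).ne')
  have hL0 : ∀ f, (∀ x, 0 ≤ f x) → ∀ x, 0 ≤ L f x := by
    intro f hf x
    obtain ⟨x, rfl⟩ := QuotientAddGroup.mk_surjective x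
    refine le_of_le_of_eq ?_ (hL f x).symm
    exact Finset.sum_nonneg fun k _ => mul_nonneg (hf _) (inv_nonneg.2 (hpos _).le)
  have hdual : ∀ f : UnitAddCircle → ℝ, Continuous f → (∀ x, 0 ≤ f x) →
      ∀ h : UnitAddCircle → ENNReal, Measurable h →
      ∫⁻ x, h (T x) * ENNReal.ofReal (f x) = ∫⁻ x, h x * ENNReal.ofReal (L f x) :=
    fun f hf hf0 h hh => duality F hFd w hFw hFm T hT G hGF hFG hGc hpos hF'c f hf hf0
      (L f) (hL f) h hh
  have hLP : ∀ f, InP Omega f → InP Omega (L f) := by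
    rintro f ⟨hc, h0, hcone, hint⟩
    refine ⟨hLc f hc, hL0 f h0, ?_, ?_⟩
    · intro x y
      rw [hL, hL, Finset.sum_mul]
      refine Finset.sum_le_sum fun k _ => ?_
      have h1 := hcone (G (x + k)) (G (y + k))
      have h2 := hdist (x + k) (y + k)
      have h3 := hGlip (x + k) (y + k)
      rw [add_sub_add_right_eq_sub] at h2 h3
      have h4 : f (G (x + k) : ℝ) ≤ f (G (y + k) : ℝ) * exp (Omega * (|x - y| / lam)) := by
        refine h1.trans ?_
        gcongr
        exact h0 _
      calc _ ≤ (f (G (y + k) : ℝ) * exp (Omega * (|x - y| / lam))) *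
            ((deriv F (G (y + k)))⁻¹ * exp (nT'' / lam ^ 2 * |x - y|)) :=
            mul_le_mul h4 h2 (inv_nonneg.2 (hpos _).le) (mul_nonneg (h0 _) (exp_pos _).le)
        _ = f (G (y + k) : ℝ) * (deriv F (G (y + k)))⁻¹ *
            (exp (Omega * (|x - y| / lam)) * exp (nT'' / lam ^ 2 * |x - y|)) := by ring
        _ = _ := by
            rw [← exp_add]
            congr 2
            rw [hOmega]
            field_simp
            ring
    · have h1 := hdual f hc h0 (fun _ => 1) measurable_const
      simp only [one_mul] at h1
      rw [← ofReal_integral_eq_lintegral_ofReal (circ_int f hc)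
          (Filter.Eventually.of_forall h0),
        ← ofReal_integral_eq_lintegral_ofReal (circ_int _ (hLc f hc))
          (Filter.Eventually.of_forall (hL0 f h0)), hint] at h1
      have h2 : 0 ≤ ∫ x, L f x := integral_nonneg (hL0 f h0)
      have := (ENNReal.ofReal_eq_ofReal_iff zero_le_one h2).1 h1
      exact this.symm
  -- iterates
  let u : ℕ → UnitAddCircle → ℝ := fun n => L^[n] (fun _ => 1)
  have hu : ∀ n, InP Omega (u n) := by
    intro n
    induction n with
    | zero =>
      refine ⟨continuous_const, fun _ => zero_le_one, fun x y => ?_, ?_⟩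
      · simp only [u, Function.iterate_zero, id, one_mul]
        exact one_le_exp (by positivity)
      · simp [u, Measure.real]
    | succ n ih =>
      simp only [u, Function.iterate_succ_apply']
      exact hLP _ ih
  have hus : ∀ n, L (u n) = u (n + 1) := fun n => (Function.iterate_succ_apply' L n _).symm
  obtain ⟨φ, s, hs, hφ, hlim⟩ := InP.compact hΩ _ (InP.avg u hu)
  have hfix : L φ = φ := by
    funext x
    obtain ⟨x, rfl⟩ := QuotientAddGroup.mk_surjective x
    -- L of averages converges
    let a : ℕ → UnitAddCircle → ℝ :=
      fun n x => ((n : ℝ) + 1)⁻¹ * ∑ k ∈ Finset.range (n + 1), u k x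
    have h1 : Filter.Tendsto (fun n => L (a (s n)) (x : UnitAddCircle)) Filter.atTop
        (nhds (L φ (x : UnitAddCircle))) := by
      simp only [hL]
      exact tendsto_finsetSum _ fun k _ => (hlim _).mul_const _
    have h2 : ∀ n, L (a n) (x : UnitAddCircle) =
        a n x + ((n : ℝ) + 1)⁻¹ * (u (n + 1) x - u 0 x) := by
      intro n
      have e1 : L (a n) (x : UnitAddCircle) =
          ((n : ℝ) + 1)⁻¹ * ∑ k ∈ Finset.range (n + 1), u (k + 1) x := by
        simp only [← hus, hL, a]
        rw [Finset.sum_comm, Finset.mul_sum]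
        refine Finset.sum_congr rfl fun k _ => ?_
        rw [mul_assoc, Finset.sum_mul]
      rw [e1, ← mul_add]
      congr 1
      have := Finset.sum_range_sub (fun k => u k (x : UnitAddCircle)) (n + 1)
      rw [Finset.sum_sub_distrib] at this
      linarith
    have h3 : Filter.Tendsto (fun n : ℕ => ((n : ℝ) + 1)⁻¹ *
        (u (n + 1) (x : UnitAddCircle) - u 0 x)) Filter.atTop (nhds 0) := by
      have hz : Filter.Tendsto (fun n : ℕ => ((n : ℝ) + 1)⁻¹ * exp Omega)
          Filter.atTop (nhds 0) := by
        have := (tendsto_one_div_add_atTop_nhds_zero_nat (𝕜 := ℝ)).mul_const (exp Omega)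
        simpa using this
      refine squeeze_zero_norm (fun n => ?_) hz
      rw [norm_mul, Real.norm_of_nonneg (by positivity : (0:ℝ) ≤ ((n : ℝ) + 1)⁻¹)]
      refine mul_le_mul_of_nonneg_left ?_ (by positivity)
      have b1 := (hu (n + 1)).bound2 hΩ x
      have b2 := (hu 0).bound2 hΩ x
      have b3 := (hu (n + 1)).2.1 x
      have b4 := (hu 0).2.1 x
      rw [Real.norm_eq_abs, abs_le]
      constructor <;> linarith
    have h4 := (hlim (x : UnitAddCircle)).add (h3.comp hs.tendsto_atTop)
    rw [add_zero] at h4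
    refine tendsto_nhds_unique h1 (h4.congr fun n => ?_)
    exact (h2 (s n)).symm
  have hTc : Continuous T := by
    apply circ_cont
    simp only [hT]
    exact hcoe.comp hFd.continuous
  refine ⟨volume.withDensity (fun x => ENNReal.ofReal (φ x)), φ, ⟨?_⟩, ?_, rfl, hφ.2.1,
    hφ.lip hΩ⟩
  · rw [withDensity_apply _ MeasurableSet.univ, Measure.restrict_univ,
      ← ofReal_integral_eq_lintegral_ofReal (circ_int φ hφ.1)
        (Filter.Eventually.of_forall hφ.2.1), hφ.2.2.2, ENNReal.ofReal_one]
  · intro A hA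
    have hTA : MeasurableSet (T ⁻¹' A) := hTc.measurable hA
    rw [withDensity_apply _ hA, withDensity_apply _ hTA, ← lintegral_indicator hA,
      ← lintegral_indicator hTA]
    have := hdual φ hφ.1 hφ.2.1 (A.indicator 1) (measurable_one.indicator hA)
    rw [hfix] at this
    refine Eq.trans (lintegral_congr fun x => ?_) (this.trans (lintegral_congr fun x => ?_))
    · by_cases hx : T x ∈ A
      · simp [Set.indicator, hx]
      · simp [Set.indicator, hx]
    · by_cases hx : x ∈ A
      · simp [Set.indicator, hx]
      · simp [Set.indicator, hx]
end

section
/- Let J ⊂ S¹ be an arc with |J| ≤ 1/2, let n ≥ 1, and let S : J → S¹ be any inverse branch of Tⁿ on J, i.e. a continuous map with Tⁿ(S(z)) = z for all z ∈ J. Then for all x, y ∈ J, e^{−Ω d(x,y)} ≤ (Tⁿ)'(S(x)) / (Tⁿ)'(S(y)) ≤ e^{Ω d(x,y)}; in particular the bound is independent of n. -/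
open MeasureTheory Real

lemma aux_expand (F : ℝ → ℝ) (hF : Differentiable ℝ F) (lam : ℝ)
    (hexp : ∀ x : ℝ, lam ≤ deriv F x) (u v : ℝ) :
    lam * |u - v| ≤ |F u - F v| := by
  rcases le_total u v with h | h
  · have := mul_sub_le_image_sub_of_le_deriv hF hexp h
    rw [abs_sub_comm u v, abs_sub_comm (F u), abs_of_nonneg (sub_nonneg.2 h)]
    exact this.trans (le_abs_self _)
  · have := mul_sub_le_image_sub_of_le_deriv hF hexp h
    rw [abs_of_nonneg (sub_nonneg.2 h)]
    exact this.trans (le_abs_self _)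

lemma aux_bdd (F : ℝ → ℝ) (hF : ContDiff ℝ 2 F) (w : ℝ)
    (hFw : ∀ x : ℝ, F (x + 1) = F x + w) :
    BddAbove (Set.range fun x : ℝ => |deriv (deriv F) x|) := by
  have h1 : Function.Periodic (deriv F) 1 := by
    intro x
    have : (fun y => F (y + 1)) = fun y => F y + w := funext hFw
    rw [← deriv_comp_add_const, this, deriv_add_const]
  have h2 : Function.Periodic (fun x => |deriv (deriv F) x|) 1 := by
    intro x
    have : (fun y => deriv F (y + 1)) = deriv F := funext h1
    simp only
    rw [← deriv_comp_add_const, this]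
  have hc : Continuous (deriv (deriv F)) := by
    have : ContDiff ℝ 1 (deriv F) := ((contDiff_succ_iff_deriv (n := 1)).1 hF).2.2
    exact this.continuous_deriv le_rfl
  have := (isCompact_Icc (a := (0:ℝ)) (b := 1)).image hc.abs
  refine this.bddAbove.mono ?_
  rintro _ ⟨x, rfl⟩
  obtain ⟨y, hy, hxy⟩ := h2.exists_mem_Ico₀ one_pos x
  exact ⟨y, Set.Ico_subset_Icc_self hy, hxy.symm⟩

lemma aux_log (F : ℝ → ℝ) (hF : ContDiff ℝ 2 F) (lam M : ℝ) (hlam : 1 < lam)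
    (hexp : ∀ x : ℝ, lam ≤ deriv F x) (hM : ∀ x, |deriv (deriv F) x| ≤ M) (u v : ℝ) :
    |Real.log (deriv F u) - Real.log (deriv F v)| ≤ M / lam * |u - v| := by
  have hd : Differentiable ℝ (deriv F) := 
    (((contDiff_succ_iff_deriv (n := 1)).1 hF).2.2).differentiable (by norm_num)
  have hpos : ∀ x, 0 < deriv F x := fun x => by linarith [hexp x]
  have hM0 : 0 ≤ M := (abs_nonneg _).trans (hM 0)
  have := Convex.norm_image_sub_le_of_norm_deriv_le (s := Set.univ) (x := v) (y := u)
    (f := fun x => Real.log (deriv F x)) (C := M / lam) 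
    (fun x _ => (hd x).log (hpos x).ne') (fun x _ => by
      rw [deriv.log (hd x) (hpos x).ne', Real.norm_eq_abs, abs_div, abs_of_pos (hpos x)]
      exact div_le_div₀ hM0 (hM x) (by linarith) (hexp x)) convex_univ trivial trivial
  simpa [Real.norm_eq_abs] using this

lemma aux_iter (F : ℝ → ℝ) (hF : ContDiff ℝ 2 F) (lam M : ℝ) (hlam : 1 < lam)
    (hexp : ∀ x : ℝ, lam ≤ deriv F x) (hM : ∀ x, |deriv (deriv F) x| ≤ M) (n : ℕ) :
    Differentiable ℝ F^[n] ∧ (∀ x, 0 < deriv F^[n] x) ∧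
    ∀ u v : ℝ, |Real.log (deriv F^[n] u) - Real.log (deriv F^[n] v)| ≤
      M / (lam * (lam - 1)) * |F^[n] u - F^[n] v| := by
  have hFd : Differentiable ℝ F := hF.differentiable (by norm_num)
  have hpos : ∀ x, 0 < deriv F x := fun x => by linarith [hexp x]
  have hM0 : 0 ≤ M := (abs_nonneg _).trans (hM 0)
  have hl : 0 < lam - 1 := by linarith
  have hl0 : 0 < lam := by linarith
  induction n with
  | zero => 
    refine ⟨differentiable_id, fun x => by simp [Function.iterate_zero], fun u v => ?_⟩
    simp only [Function.iterate_zero, deriv_id, sub_self, abs_zero]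
    positivity
  | succ n ih =>
    obtain ⟨h1, h2, h3⟩ := ih
    have hder : ∀ x, deriv F^[n+1] x = deriv F (F^[n] x) * deriv F^[n] x := by
      intro x
      rw [Function.iterate_succ', deriv_comp _ (hFd _) (h1 _)]
    refine ⟨by rw [Function.iterate_succ']; exact hFd.comp h1,
      fun x => by rw [hder]; exact mul_pos (hpos _) (h2 _), fun u v => ?_⟩
    rw [hder, hder, Real.log_mul (hpos _).ne' (h2 _).ne', Real.log_mul (hpos _).ne' (h2 _).ne']
    have e1 := aux_log F hF lam M hlam hexp hM (F^[n] u) (F^[n] v)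
    have e2 := h3 u v
    have e3 := aux_expand F hFd lam hexp (F^[n] u) (F^[n] v)
    rw [Function.iterate_succ_apply', Function.iterate_succ_apply']
    set p := F^[n] u
    set q := F^[n] v
    calc _ = |(Real.log (deriv F p) - Real.log (deriv F q)) + 
          (Real.log (deriv F^[n] u) - Real.log (deriv F^[n] v))| := by congr 1; ring
      _ ≤ M / lam * |p - q| + M / (lam * (lam - 1)) * |p - q| := (abs_add_le _ _).trans (add_le_add e1 e2)
      _ = M / (lam * (lam - 1)) * (lam * |p - q|) := by field_simp; ring
      _ ≤ _ := by gcongr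

lemma aux_lift (G : ℝ → ℝ) (hG : Continuous G) (S : UnitAddCircle → UnitAddCircle)
    (a b : ℝ) (hS : ContinuousOn S ((fun x : ℝ => (x : UnitAddCircle)) '' Set.Icc a b))
    (hb : ∀ t ∈ Set.Icc a b, ∀ s : ℝ, (s : UnitAddCircle) = S t → ((G s : ℝ) : UnitAddCircle) = t)
    (t₁ t₂ : ℝ) (h₁ : t₁ ∈ Set.Icc a b) (h₂ : t₂ ∈ Set.Icc a b) :
    ∃ u v : ℝ, (u : UnitAddCircle) = S t₁ ∧ (v : UnitAddCircle) = S t₂ ∧ G u - G v = t₁ - t₂ := by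
  let c : unitInterval → ℝ := fun τ => t₂ + τ * (t₁ - t₂)
  have hc : Continuous c := by fun_prop
  have hmem : ∀ τ, c τ ∈ Set.Icc a b := by
    intro τ
    have := (convex_Icc a b).add_smul_sub_mem h₂ h₁ τ.2
    simpa [c] using this
  let γ : C(unitInterval, UnitAddCircle) := ⟨fun τ => S (c τ), 
    hS.comp_continuous ((AddCircle.continuous_mk' 1).comp hc) fun τ => ⟨c τ, hmem τ, rfl⟩⟩
  obtain ⟨e, he⟩ := QuotientAddGroup.mk_surjective (γ 0)
  obtain ⟨Γ, hΓ, -⟩ := (AddCircle.isCoveringMap_coe (1:ℝ)).exists_path_lifts γ e he.symm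
  have hΓ' : ∀ τ, ((Γ τ : ℝ) : UnitAddCircle) = S (c τ) := fun τ => congrFun hΓ τ
  have hint : ∀ τ, ∃ k : ℤ, (k : ℝ) = G (Γ τ) - c τ := by
    intro τ
    have := hb (c τ) (hmem τ) (Γ τ) (hΓ' τ)
    rw [← sub_eq_zero, ← AddCircle.coe_sub, AddCircle.coe_eq_zero_iff] at this
    obtain ⟨k, hk⟩ := this
    exact ⟨k, by simpa using hk⟩
  choose k hk using hint
  have hkc : Continuous k := by
    rw [Int.isClosedEmbedding_coe_real.isInducing.continuous_iff]
    have : ((↑) : ℤ → ℝ) ∘ k = fun τ => G (Γ τ) - c τ := funext hk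
    rw [this]
    fun_prop
  have hkk : k 1 = k 0 := PreconnectedSpace.constant inferInstance hkc
  have c0 : c 0 = t₂ := by simp [c]
  have c1 : c 1 = t₁ := by simp [c]
  refine ⟨Γ 1, Γ 0, by rw [hΓ', c1], by rw [hΓ', c0], ?_⟩
  have a1 := hk 1
  have a0 := hk 0
  rw [hkk] at a1
  rw [c1] at a1
  rw [c0] at a0
  linarith

theorem distortion_bound
    (F : ℝ → ℝ) (hF : ContDiff ℝ 2 F)
    (w : ℕ) (hw : 0 < w) (hFw : ∀ x : ℝ, F (x + 1) = F x + w)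
    (T : UnitAddCircle → UnitAddCircle) (hT : ∀ x : ℝ, T ↑x = (↑(F x) : UnitAddCircle))
    (lam : ℝ) (hlam : 1 < lam) (hexp : ∀ x : ℝ, lam ≤ deriv F x)
    (nT'' : ℝ) (hnT'' : nT'' = ⨆ x : ℝ, |deriv (deriv F) x|)
    (Omega : ℝ) (hOmega : Omega = nT'' / (lam * (lam - 1)))
    (a b : ℝ) (hab : a ≤ b) (hlen : b - a ≤ 1 / 2)
    (J : Set UnitAddCircle) (hJ : J = (fun x : ℝ => (x : UnitAddCircle)) '' Set.Icc a b)
    (n : ℕ) (hn : 1 ≤ n)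
    (S : UnitAddCircle → UnitAddCircle) (hScont : ContinuousOn S J)
    (hSbranch : ∀ z ∈ J, T^[n] (S z) = z)
    (Dn : UnitAddCircle → ℝ) (hDn : ∀ x : ℝ, Dn ↑x = deriv (F^[n]) x) :
    ∀ x ∈ J, ∀ y ∈ J,
      Real.exp (-(Omega * dist x y)) ≤ Dn (S x) / Dn (S y) ∧
      Dn (S x) / Dn (S y) ≤ Real.exp (Omega * dist x y) := by
  rintro x hx y hy
  have hM : ∀ x, |deriv (deriv F) x| ≤ nT'' := fun x => by
    rw [hnT'']
    exact le_ciSup (aux_bdd F hF w hFw) x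
  obtain ⟨h1, h2, h3⟩ := aux_iter F hF lam nT'' hlam hexp hM n
  have hTn : ∀ s : ℝ, T^[n] (s : UnitAddCircle) = ((F^[n] s : ℝ) : UnitAddCircle) := by
    intro s
    have : Function.Semiconj (fun x : ℝ => (x : UnitAddCircle)) F T := fun x => (hT x).symm
    exact ((this.iterate_right n) s).symm
  subst hJ
  obtain ⟨t₁, ht₁, rfl⟩ := hx
  obtain ⟨t₂, ht₂, rfl⟩ := hy
  obtain ⟨u, v, hu, hv, huv⟩ := aux_lift F^[n] h1.continuous S a b hScont (by
    intro t ht s hs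
    rw [← hTn, hs]
    exact hSbranch _ ⟨t, ht, rfl⟩) t₁ t₂ ht₁ ht₂
  have hd : dist (t₁ : UnitAddCircle) (t₂ : UnitAddCircle) = |t₁ - t₂| := by
    rw [dist_eq_norm, ← AddCircle.coe_sub, AddCircle.norm_coe_eq_abs_iff (1:ℝ) one_ne_zero, abs_one,
      abs_le]
    constructor <;> linarith [ht₁.1, ht₁.2, ht₂.1, ht₂.2]
  have key := h3 u v
  rw [huv, ← hOmega] at key
  simp only
  rw [hd, ← hu, ← hv, hDn, hDn]
  rw [← Real.log_div (h2 u).ne' (h2 v).ne'] at key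
  have hp : 0 < deriv F^[n] u / deriv F^[n] v := div_pos (h2 u) (h2 v)
  rw [← Real.le_log_iff_exp_le hp, ← Real.log_le_iff_le_exp hp]
  exact abs_le.1 key
end

section
/- Fix α ∈ (0,1]. Suppose ψ : S¹ → ℝ is a strictly positive probability density (ψ > 0, ∫ ψ dm = 1) with H_α(log ψ) < ∞. Then for every n ∈ ℕ, Lⁿψ is a strictly positive probability density with H_α(log Lⁿψ) < ∞, and H_α(log Lⁿψ) ≤ λ^{−αn}·H_α(log ψ) + Ω. -/
open MeasureTheory Real


/-- `holderBound α f H` asserts that `H` is an upper bound for the `α`-Hölder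
constant of `f`, i.e. `|f x - f y| ≤ H · d(x,y)^α` for all `x, y`. -/
def holderBound (α : ℝ) (f : UnitAddCircle → ℝ) (H : ℝ) : Prop :=
  ∀ x y : UnitAddCircle, |f x - f y| ≤ H * dist x y ^ α

lemma HLT_expand (F : ℝ → ℝ) (hF : Differentiable ℝ F) (lam : ℝ)
    (hexp : ∀ x : ℝ, lam ≤ deriv F x) (x y : ℝ) (hxy : x ≤ y) :
    lam * (y - x) ≤ F y - F x :=
  mul_sub_le_image_sub_of_le_deriv hF hexp hxy

/-- existence of the inverse lift -/
lemma HLT_inv (F : ℝ → ℝ) (hF : ContDiff ℝ 2 F)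
    (w : ℕ) (hFw : ∀ x : ℝ, F (x + 1) = F x + w)
    (lam : ℝ) (hlam : 1 < lam) (hexp : ∀ x : ℝ, lam ≤ deriv F x) :
    ∃ G : ℝ → ℝ, (∀ t, F (G t) = t) ∧ (∀ s, G (F s) = s) ∧
      (∀ s t, |G s - G t| ≤ |s - t| / lam) ∧ (∀ t, G (t + w) = G t + 1) ∧
      Continuous G ∧ (∀ t, HasDerivAt G (deriv F (G t))⁻¹ t) := by
  have hl0 : 0 < lam := by linarith
  have hd : Differentiable ℝ F := hF.differentiable (by norm_num)
  have hE := HLT_expand F hd lam hexp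
  have hab : ∀ x y, lam * |y - x| ≤ |F y - F x| := by
    intro x y
    rcases le_total x y with h | h
    · rw [abs_of_nonneg (sub_nonneg.2 h)]
      exact (hE x y h).trans (le_abs_self _)
    · rw [abs_sub_comm, abs_sub_comm (F y), abs_of_nonneg (sub_nonneg.2 h)]
      exact (hE y x h).trans (le_abs_self _)
  have hinj : Function.Injective F := by
    intro x y h
    have := hab x y
    rw [h, sub_self, abs_zero] at this
    have h0 : |y - x| = 0 := le_antisymm (by nlinarith [abs_nonneg (y - x)]) (abs_nonneg _)
    linarith [abs_eq_zero.1 h0]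
  have hsurj : Function.Surjective F := by
    apply hd.continuous.surjective
    · refine Filter.tendsto_atTop_mono' (f₁ := fun x => lam * x + F 0) _ ?_ ?_
      · filter_upwards [Filter.eventually_ge_atTop 0] with x hx
        have := hE 0 x hx
        linarith
      · exact Filter.tendsto_atTop_add_const_right _ _ (Filter.tendsto_id.const_mul_atTop hl0)
    · refine Filter.tendsto_atBot_mono' (f₂ := F) (f₁ := fun x => lam * x + F 0) _ ?_ ?_
      · filter_upwards [Filter.eventually_le_atBot 0] with x hx
        have := hE x 0 hx
        linarith
      · exact Filter.tendsto_atBot_add_const_right _ _ (Filter.tendsto_id.const_mul_atBot hl0)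
  choose G hG using hsurj
  have hGF : ∀ s, G (F s) = s := fun s => hinj (hG _)
  have hlip : ∀ s t, |G s - G t| ≤ |s - t| / lam := by
    intro s t
    rw [le_div_iff₀ hl0]
    have := hab (G t) (G s)
    rw [hG, hG] at this
    linarith
  have hcont : Continuous G := by
    have : LipschitzWith (Real.toNNReal lam⁻¹) G := by
      apply LipschitzWith.of_dist_le_mul
      intro x y
      rw [Real.coe_toNNReal _ (by positivity), Real.dist_eq, Real.dist_eq]
      have := hlip x y
      rwa [div_eq_inv_mul] at this
    exact this.continuous
  refine ⟨G, hG, hGF, hlip, ?_, hcont, ?_⟩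
  · intro t
    apply hinj
    rw [hG, hFw, hG]
  · intro t
    apply HasDerivAt.of_local_left_inverse hcont.continuousAt (hd (G t)).hasDerivAt
    · have := hexp (G t)
      linarith
    · exact Filter.Eventually.of_forall hG

lemma HLT_int_shift (F : ℝ → ℝ) (w : ℕ) (hFw : ∀ x : ℝ, F (x + 1) = F x + w) (m : ℤ) :
    ∀ x, F (x + m) = F x + m * w := by
  induction m using Int.induction_on with
  | zero => simp
  | succ i ih =>
    intro x
    have := hFw (x + i)
    have h2 := ih x
    push_cast at *
    rw [← add_assoc, this, h2]; ring
  | pred i ih =>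
    intro x
    have h2 := ih x
    have := hFw (x + (-(i:ℝ) - 1))
    push_cast at *
    rw [show x + (-(i:ℝ) - 1) + 1 = x + -(i:ℝ) by ring, h2] at this
    linarith

lemma HLT_coe_eq (x y : ℝ) : (x : UnitAddCircle) = y ↔ ∃ n : ℤ, x = y + n := by
  rw [← sub_eq_zero, ← AddCircle.coe_sub, AddCircle.coe_eq_zero_iff]
  constructor
  · rintro ⟨n, hn⟩
    refine ⟨n, ?_⟩
    simp at hn
    linarith
  · rintro ⟨n, hn⟩
    refine ⟨n, ?_⟩
    simp
    linarith

/-- The transfer operator as a finite sum. -/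
lemma HLT_sum (F : ℝ → ℝ)
    (w : ℕ) (hw : 0 < w) (hFw : ∀ x : ℝ, F (x + 1) = F x + w)
    (T : UnitAddCircle → UnitAddCircle) (hT : ∀ x : ℝ, T ↑x = (↑(F x) : UnitAddCircle))
    (G : ℝ → ℝ) (hFG : ∀ t, F (G t) = t) (hGF : ∀ s, G (F s) = s)
    (f : UnitAddCircle → ℝ) (X : ℝ) :
    ∑' y : (T ⁻¹' {(X : UnitAddCircle)}), f y =
      ∑ k ∈ Finset.range w, f (G (X + k) : ℝ) := by
  have hmem : ∀ k : ℕ, ((G (X + k) : ℝ) : UnitAddCircle) ∈ T ⁻¹' {(X : UnitAddCircle)} := by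
    intro k
    rw [Set.mem_preimage, Set.mem_singleton_iff, hT, hFG, HLT_coe_eq]
    exact ⟨k, by simp⟩
  let e : Fin w → T ⁻¹' {(X : UnitAddCircle)} := fun k => ⟨((G (X + (k : ℕ)) : ℝ) : UnitAddCircle), hmem k⟩
  have he : Function.Bijective e := by
    constructor
    · intro k j hkj
      have h1 : ((G (X + (k : ℕ)) : ℝ) : UnitAddCircle) = ((G (X + (j : ℕ)) : ℝ) : UnitAddCircle) :=
        congrArg Subtype.val hkj
      rw [HLT_coe_eq] at h1
      obtain ⟨n, hn⟩ := h1
      have h2 := congrArg F hn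
      rw [HLT_int_shift F w hFw, hFG, hFG] at h2
      have h3 : ((k : ℕ) : ℤ) = ((j : ℕ) : ℤ) + n * w := by
        have : (((k : ℕ) : ℤ) : ℝ) = ((((j : ℕ) : ℤ) + n * w : ℤ) : ℝ) := by
          push_cast; linarith
        exact_mod_cast this
      have hk := k.2
      have hj := j.2
      apply Fin.ext
      have h4 : ((k : ℕ) : ℤ) % w = ((j : ℕ) : ℤ) % w := by
        rw [h3, Int.add_mul_emod_self_right]
      rw [Int.emod_eq_of_lt (by omega) (by omega), Int.emod_eq_of_lt (by omega) (by omega)] at h4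
      omega
    · rintro ⟨y, hy⟩
      obtain ⟨s, rfl⟩ := QuotientAddGroup.mk_surjective y
      change ((s : ℝ) : UnitAddCircle) ∈ _ at hy
      rw [Set.mem_preimage, Set.mem_singleton_iff, hT, HLT_coe_eq] at hy
      obtain ⟨n, hn⟩ := hy
      have hwz : (0 : ℤ) < w := by exact_mod_cast hw
      have hr0 := Int.emod_nonneg n hwz.ne'
      have hr1 := Int.emod_lt_of_pos n hwz
      refine ⟨⟨(n % w).toNat, by omega⟩, ?_⟩
      apply Subtype.ext
      change ((G (X + ((n % w).toNat : ℕ)) : ℝ) : UnitAddCircle) = ((s : ℝ) : UnitAddCircle)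
      rw [HLT_coe_eq]
      refine ⟨-(n / w), ?_⟩
      rw [← hGF (s + ((-(n / w) : ℤ) : ℝ))]
      congr 1
      rw [HLT_int_shift F w hFw, hn]
      have h1 : (((n % w).toNat : ℕ) : ℤ) = n % w := Int.toNat_of_nonneg hr0
      have h2 : (((n % w).toNat : ℕ) : ℝ) = ((n % w : ℤ) : ℝ) := by exact_mod_cast h1
      have h3 : ((n % w : ℤ) : ℝ) + w * ((n / w : ℤ) : ℝ) = n := by
        exact_mod_cast Int.emod_add_mul_ediv n w
      rw [h2]
      push_cast
      linarith
  rw [← Equiv.tsum_eq (Equiv.ofBijective e he) (fun y : (T ⁻¹' {(X : UnitAddCircle)}) => f y),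
    tsum_fintype, ← Fin.sum_univ_eq_sum_range (fun k => f (G (X + k) : ℝ))]
  rfl

/-- Mass preservation. -/
lemma HLT_integral (F : ℝ → ℝ) (hF : ContDiff ℝ 2 F) (w : ℕ)
    (hpos : ∀ x, 0 < deriv F x)
    (G : ℝ → ℝ) (hGc : Continuous G) (hGd : ∀ t, HasDerivAt G (deriv F (G t))⁻¹ t)
    (hGw : ∀ t, G (t + w) = G t + 1)
    (u v : UnitAddCircle → ℝ) (hu : Continuous u)
    (hv : ∀ X : ℝ, v X = ∑ k ∈ Finset.range w, u (G (X + k) : ℝ) / deriv F (G (X + k))) :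
    ∫ x, v x = ∫ x, u x := by
  have hdc : Continuous (deriv F) := hF.continuous_deriv (by norm_num)
  have hmk : Continuous (fun s : ℝ => (s : UnitAddCircle)) := AddCircle.continuous_mk' 1
  have hg : Continuous (fun s : ℝ => u (s : UnitAddCircle)) := hu.comp hmk
  have hc : Continuous (fun t => u (G t : ℝ) / deriv F (G t)) :=
    (hg.comp hGc).div (hdc.comp hGc) (fun x => (hpos _).ne')
  rw [← UnitAddCircle.intervalIntegral_preimage 0 v, ← UnitAddCircle.intervalIntegral_preimage (G 0) u]
  simp_rw [hv]
  rw [intervalIntegral.integral_finsetSum]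
  · have h1 : ∀ k ∈ Finset.range w, ∫ x in (0:ℝ)..(0+1), u (G (x + k) : ℝ) / deriv F (G (x + k))
        = ∫ x in ((k : ℕ) : ℝ)..((k + 1 : ℕ) : ℝ), u (G x : ℝ) / deriv F (G x) := by
      intro k _
      rw [intervalIntegral.integral_comp_add_right (fun x => u (G x : ℝ) / deriv F (G x))]
      congr 1
      · simp
      · push_cast; ring
    rw [Finset.sum_congr rfl h1,
      intervalIntegral.sum_integral_adjacent_intervals (a := fun k : ℕ => (k : ℝ))
        (fun k _ => hc.intervalIntegrable _ _)]
    have h2 := intervalIntegral.integral_comp_mul_deriv (a := 0) (b := (w : ℝ)) (f := G)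
      (f' := fun t => (deriv F (G t))⁻¹) (g := fun s : ℝ => u (s : UnitAddCircle))
      (fun x _ => hGd x) ((hdc.comp hGc).inv₀ (fun x => (hpos _).ne')).continuousOn hg
    have h3 : G w = G 0 + 1 := by simpa using hGw 0
    rw [h3] at h2
    rw [← h2]
    simp [div_eq_mul_inv]
  · intro k _
    exact (hc.comp (continuous_add_const _)).intervalIntegrable _ _

/-- Distortion of one branch. -/
lemma HLT_logderiv (F : ℝ → ℝ) (hF : ContDiff ℝ 2 F) (lam M : ℝ) (hlam : 1 < lam)
    (hexp : ∀ x : ℝ, lam ≤ deriv F x) (hM : ∀ x, |deriv (deriv F) x| ≤ M) (a b : ℝ) :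
    |Real.log (deriv F a) - Real.log (deriv F b)| ≤ M / lam * |a - b| := by
  have hF' : ContDiff ℝ 1 (deriv F) := by
    have : ContDiff ℝ (1 + 1) F := by simpa [one_add_one_eq_two] using hF
    exact (contDiff_succ_iff_deriv.1 this).2.2
  have hpos : ∀ x, 0 < deriv F x := fun x => by linarith [hexp x]
  have hd : ∀ x, HasDerivAt (fun x => Real.log (deriv F x)) (deriv (deriv F) x / deriv F x) x := by
    intro x
    exact ((hF'.differentiable (by norm_num)) x).hasDerivAt.log (hpos x).ne'
  have := convex_univ.norm_image_sub_le_of_norm_hasDerivWithin_le (x := b) (y := a)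
    (f := fun x => Real.log (deriv F x)) (C := M / lam)
    (fun x _ => (hd x).hasDerivWithinAt) (fun x _ => ?_) (Set.mem_univ _) (Set.mem_univ _)
  · simpa [Real.norm_eq_abs] using this
  · rw [norm_div, Real.norm_eq_abs, Real.norm_eq_abs, abs_of_pos (hpos x)]
    have := abs_nonneg (deriv (deriv F) x)
    exact div_le_div₀ (this.trans (hM x)) (hM x) (by linarith) (hexp x)

lemma HLT_lift_pair (x y : UnitAddCircle) :
    ∃ X Y : ℝ, (X : UnitAddCircle) = x ∧ (Y : UnitAddCircle) = y ∧ |X - Y| = dist x y := by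
  obtain ⟨X, rfl⟩ := QuotientAddGroup.mk_surjective x
  obtain ⟨Y, rfl⟩ := QuotientAddGroup.mk_surjective y
  refine ⟨X - round (X - Y), Y, ?_, rfl, ?_⟩
  · change ((X - round (X - Y) : ℝ) : UnitAddCircle) = (X : UnitAddCircle)
    rw [HLT_coe_eq]
    exact ⟨-round (X - Y), by push_cast; ring⟩
  · change _ = dist (X : UnitAddCircle) (Y : UnitAddCircle)
    rw [dist_eq_norm, ← AddCircle.coe_sub, UnitAddCircle.norm_eq]
    congr 1; ring

lemma HLT_dist_le (X Y : ℝ) : dist (X : UnitAddCircle) (Y : UnitAddCircle) ≤ |X - Y| := by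
  rw [dist_eq_norm, ← AddCircle.coe_sub, UnitAddCircle.norm_eq]
  simpa using round_le (X - Y) 0

lemma HLT_logsum (w : ℕ) (hw : 0 < w) (a b : ℕ → ℝ) (ha : ∀ k, 0 < a k) (hb : ∀ k, 0 < b k)
    (c : ℝ) (h : ∀ k, Real.log (a k) - Real.log (b k) ≤ c) :
    Real.log (∑ k ∈ Finset.range w, a k) - Real.log (∑ k ∈ Finset.range w, b k) ≤ c := by
  have hne : (Finset.range w).Nonempty := Finset.nonempty_range_iff.2 hw.ne'
  have hA : 0 < ∑ k ∈ Finset.range w, a k := Finset.sum_pos (fun k _ => ha k) hne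
  have hB : 0 < ∑ k ∈ Finset.range w, b k := Finset.sum_pos (fun k _ => hb k) hne
  have h1 : ∑ k ∈ Finset.range w, a k ≤ Real.exp c * ∑ k ∈ Finset.range w, b k := by
    rw [Finset.mul_sum]
    refine Finset.sum_le_sum fun k _ => ?_
    have h2 : Real.log (a k) ≤ c + Real.log (b k) := by linarith [h k]
    rw [Real.log_le_iff_le_exp (ha k), Real.exp_add, Real.exp_log (hb k)] at h2
    exact h2
  have h3 := Real.log_le_log hA h1
  rw [Real.log_mul (Real.exp_pos c).ne' hB.ne', Real.log_exp] at h3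
  linarith

lemma HLT_cont (α : ℝ) (hα : 0 < α) (A B : ℝ) (u : UnitAddCircle → ℝ) (hpos : ∀ x, 0 < u x)
    (h : ∀ x y, |Real.log (u x) - Real.log (u y)| ≤ A * dist x y ^ α + B * dist x y) :
    Continuous u := by
  have h1 : Continuous (fun x => Real.log (u x)) := by
    rw [continuous_iff_continuousAt]
    intro y
    rw [ContinuousAt, tendsto_iff_dist_tendsto_zero]
    have h2 : Filter.Tendsto (fun x => A * dist x y ^ α + B * dist x y) (nhds y) (nhds 0) := by
      have : Continuous (fun x => A * dist x y ^ α + B * dist x y) := by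
        refine (continuous_const.mul ?_).add (by fun_prop)
        exact (continuous_id.dist continuous_const).rpow_const (fun _ => Or.inr hα.le)
      have h3 := this.tendsto y
      simpa [Real.zero_rpow hα.ne'] using h3
    exact squeeze_zero (fun _ => dist_nonneg) (fun x => by rw [Real.dist_eq]; exact h x y) h2
  have h2 : u = fun x => Real.exp (Real.log (u x)) := by
    funext x; rw [Real.exp_log (hpos x)]
  rw [h2]
  exact Real.continuous_exp.comp h1

theorem holder_log_transfer_bound
    (F : ℝ → ℝ) (hF : ContDiff ℝ 2 F)
    (w : ℕ) (hw : 0 < w) (hFw : ∀ x : ℝ, F (x + 1) = F x + w)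
    (T : UnitAddCircle → UnitAddCircle) (hT : ∀ x : ℝ, T ↑x = (↑(F x) : UnitAddCircle))
    (lam : ℝ) (hlam : 1 < lam) (hexp : ∀ x : ℝ, lam ≤ deriv F x)
    (nT'' : ℝ) (hnT'' : nT'' = ⨆ x : ℝ, |deriv (deriv F) x|)
    (Omega : ℝ) (hOmega : Omega = nT'' / (lam * (lam - 1)))
    (T' : UnitAddCircle → ℝ) (hT'lift : ∀ x : ℝ, T' ↑x = deriv F x)
    (L : (UnitAddCircle → ℝ) → (UnitAddCircle → ℝ))
    (hL : ∀ u : UnitAddCircle → ℝ, ∀ x : UnitAddCircle,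
      L u x = ∑' y : (T ⁻¹' {x}), u y / T' y)
    (α : ℝ) (hα : 0 < α) (hα1 : α ≤ 1)
    (ψ : UnitAddCircle → ℝ) (hpos : ∀ x, 0 < ψ x) (hnorm : ∫ x, ψ x = 1)
    (H : ℝ) (hH : holderBound α (fun x => Real.log (ψ x)) H) :
    ∀ n : ℕ, (∀ x, 0 < (L^[n] ψ) x) ∧ (∫ x, (L^[n] ψ) x = 1) ∧
      holderBound α (fun x => Real.log ((L^[n] ψ) x))
        (lam ^ (-(α * (n : ℝ))) * H + Omega) := by
  have hl0 : 0 < lam := by linarith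
  have hl1 : 0 < lam - 1 := by linarith
  have hpF : ∀ x, 0 < deriv F x := fun x => by linarith [hexp x]
  have hF' : ContDiff ℝ 1 (deriv F) := by
    have : ContDiff ℝ (1 + 1) F := by simpa [one_add_one_eq_two] using hF
    exact (contDiff_succ_iff_deriv.1 this).2.2
  have hper1 : ∀ x, deriv F (x + 1) = deriv F x := by
    intro x
    have h1 : (fun x => F (x + 1)) = fun x => F x + w := funext hFw
    have h2 := congrArg (fun f => deriv f x) h1
    simpa [deriv_comp_add_const] using h2
  have hper2 : ∀ x, deriv (deriv F) (x + 1) = deriv (deriv F) x := by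
    intro x
    have h1 : (fun x => deriv F (x + 1)) = fun x => deriv F x := funext hper1
    have h2 := congrArg (fun f => deriv f x) h1
    simpa [deriv_comp_add_const] using h2
  have hM : ∀ x, |deriv (deriv F) x| ≤ nT'' := by
    have hc : Continuous (fun x => |deriv (deriv F) x|) := (hF'.continuous_deriv le_rfl).abs
    have hp : Function.Periodic (fun x => |deriv (deriv F) x|) 1 := fun x => by
      simp only [hper2]
    have hb := (hp.isBounded_of_continuous one_ne_zero hc).bddAbove
    intro x
    rw [hnT'']
    exact le_ciSup hb x
  have hM0 : 0 ≤ nT'' := (abs_nonneg _).trans (hM 0)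
  have hO0 : 0 ≤ Omega := by rw [hOmega]; positivity
  obtain ⟨G, hFG, hGF, hlip, hGw, hGc, hGd⟩ := HLT_inv F hF w hFw lam hlam hexp
  have hLs : ∀ (u : UnitAddCircle → ℝ) (X : ℝ), L u X =
      ∑ k ∈ Finset.range w, u (G (X + k) : ℝ) / deriv F (G (X + k)) := by
    intro u X
    rw [hL, HLT_sum F w hw hFw T hT G hFG hGF (fun y => u y / T' y) X]
    simp_rw [hT'lift]
  have hH0 : 0 ≤ H := by
    have h1 := (abs_nonneg _).trans (hH ((1/2 : ℝ) : UnitAddCircle) ((0 : ℝ) : UnitAddCircle))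
    have h2 : 0 < dist ((1/2 : ℝ) : UnitAddCircle) ((0 : ℝ) : UnitAddCircle) := by
      rw [dist_pos, Ne, HLT_coe_eq]
      rintro ⟨n, hn⟩
      have h3 : ((1 : ℤ) : ℝ) = ((2 * n : ℤ) : ℝ) := by push_cast; linarith
      have h4 : (1 : ℤ) = 2 * n := by exact_mod_cast h3
      omega
    exact nonneg_of_mul_nonneg_left h1 (Real.rpow_pos_of_pos h2 α)
  have hkey : ∀ n : ℕ, (∀ x, 0 < (L^[n] ψ) x) ∧ (∫ x, (L^[n] ψ) x = 1) ∧
      ∀ x y, |Real.log ((L^[n] ψ) x) - Real.log ((L^[n] ψ) y)| ≤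
        (lam ^ (-(α * (n : ℝ))) * H) * dist x y ^ α + Omega * dist x y := by
    intro n
    induction n with
    | zero =>
      refine ⟨hpos, hnorm, fun x y => ?_⟩
      have h1 := hH x y
      have h2 : 0 ≤ Omega * dist x y := mul_nonneg hO0 dist_nonneg
      simp only [Function.iterate_zero, id, Nat.cast_zero, mul_zero, neg_zero, Real.rpow_zero,
        one_mul]
      simp only at h1
      linarith
    | succ n ih =>
      obtain ⟨ihp, ihi, ihh⟩ := ih
      simp only [Function.iterate_succ', Function.comp_apply]
      generalize L^[n] ψ = u at ihp ihi ihh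
      have hterm : ∀ t : ℝ, 0 < u (G t : ℝ) / deriv F (G t) := fun t => div_pos (ihp _) (hpF _)
      have hone : ∀ X Y : ℝ, Real.log (L u X) - Real.log (L u Y) ≤
          (lam ^ (-(α * ((n + 1 : ℕ) : ℝ))) * H) * |X - Y| ^ α + Omega * |X - Y| := by
        intro X Y
        rw [hLs, hLs]
        apply HLT_logsum w hw _ _ (fun k => hterm _) (fun k => hterm _)
        intro k
        rw [Real.log_div (ihp _).ne' (hpF _).ne', Real.log_div (ihp _).ne' (hpF _).ne']
        have hd := hlip (X + k) (Y + k)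
        rw [show X + (k : ℝ) - (Y + k) = X - Y by ring] at hd
        have h1 := (le_abs_self _).trans (ihh (G (X + k) : ℝ) (G (Y + k) : ℝ))
        have h2 := neg_le_of_abs_le (HLT_logderiv F hF lam nT'' hlam hexp hM (G (X + k)) (G (Y + k)))
        have h3 := (HLT_dist_le (G (X + k)) (G (Y + k))).trans hd
        have h4 : dist ((G (X + k) : ℝ) : UnitAddCircle) ((G (Y + k) : ℝ) : UnitAddCircle) ^ α
            ≤ lam ^ (-α) * |X - Y| ^ α := by
          refine (Real.rpow_le_rpow dist_nonneg h3 hα.le).trans (le_of_eq ?_)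
          rw [Real.div_rpow (abs_nonneg _) hl0.le, Real.rpow_neg hl0.le, div_eq_inv_mul]
        have hA0 : 0 ≤ lam ^ (-(α * (n : ℝ))) * H := mul_nonneg (Real.rpow_nonneg hl0.le _) hH0
        have h5 := mul_le_mul_of_nonneg_left h4 hA0
        have h6 := mul_le_mul_of_nonneg_left h3 hO0
        have h7 := mul_le_mul_of_nonneg_left hd (div_nonneg hM0 hl0.le)
        have h8 : lam ^ (-(α * ((n + 1 : ℕ) : ℝ))) = lam ^ (-(α * (n : ℝ))) * lam ^ (-α) := by
          rw [← Real.rpow_add hl0]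
          congr 1
          push_cast
          ring
        have h9 : Omega * (|X - Y| / lam) + nT'' / lam * (|X - Y| / lam) = Omega * |X - Y| := by
          rw [hOmega]
          field_simp
          ring
        have h10 : lam ^ (-(α * (n : ℝ))) * H * (lam ^ (-α) * |X - Y| ^ α) =
          lam ^ (-(α * ((n + 1 : ℕ) : ℝ))) * H * |X - Y| ^ α := by rw [h8]; ring
        linarith
      refine ⟨?_, ?_, ?_⟩
      · intro x
        obtain ⟨X, rfl⟩ := QuotientAddGroup.mk_surjective x
        change 0 < L u (X : UnitAddCircle)
        rw [hLs]
        exact Finset.sum_pos (fun k _ => hterm _) (Finset.nonempty_range_iff.2 hw.ne')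
      · refine Eq.trans ?_ ihi
        exact HLT_integral F hF w hpF G hGc hGd hGw u (L u)
          (HLT_cont α hα _ _ u ihp ihh) (hLs u)
      · intro x y
        obtain ⟨X, Y, rfl, rfl, hXY⟩ := HLT_lift_pair x y
        rw [← hXY, abs_le]
        constructor
        · have := hone Y X
          rw [abs_sub_comm Y X] at this
          linarith
        · exact hone X Y
  intro n
  obtain ⟨h1, h2, h3⟩ := hkey n
  refine ⟨h1, h2, fun x y => (h3 x y).trans ?_⟩
  rw [add_mul]
  have hd1 : dist x y ≤ 1 := by
    have := AddCircle.norm_le_half_period (1 : ℝ) (x := x - y) one_ne_zero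
    rw [← dist_eq_norm] at this
    norm_num at this
    linarith
  have hd2 : dist x y ≤ dist x y ^ α := by
    rcases eq_or_lt_of_le (dist_nonneg (x := x) (y := y)) with h | h
    · rw [← h, Real.zero_rpow hα.ne']
    · simpa using Real.rpow_le_rpow_of_exponent_ge h hd1 hα1
  have := mul_le_mul_of_nonneg_left hd2 hO0
  linarith
end

section
/- Any two T-invariant ergodic Borel probability measures on S¹ that are absolutely continuous with respect to m are equal; that is, there is at most one ergodic absolutely continuous T-invariant probability measure. -/
open MeasureTheory Real

open Filter Topology Set in
theorem acim_zero_one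
    (F : ℝ → ℝ) (hF : ContDiff ℝ 2 F)
    (w : ℕ) (hFw : ∀ x : ℝ, F (x + 1) = F x + w)
    (lam : ℝ) (hlam : 1 < lam) (hexp : ∀ x : ℝ, lam ≤ deriv F x)
    (A : Set ℝ) (hA : MeasurableSet A) (hinv : F ⁻¹' A = A) (M : ENNReal)
    (hM : ∀ t : ℝ, volume (A ∩ Ioc t (t + 1)) = M) (hAc : volume Aᶜ ≠ 0) : M = 0 := by
  have hd : Differentiable ℝ F := hF.differentiable (by norm_num)
  have hd1 : ContDiff ℝ 1 (deriv F) := by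
    have : ContDiff ℝ (1 + 1) F := by simpa [one_add_one_eq_two] using hF
    exact (contDiff_succ_iff_deriv.1 this).2.2
  have hdd : Differentiable ℝ (deriv F) := hd1.differentiable (by norm_num)
  have hd2 : Continuous (deriv (deriv F)) := hd1.continuous_deriv (by norm_num)
  have hper1 : Function.Periodic (deriv F) 1 := by
    intro x
    have h : (fun x => F (x + 1)) = fun x => F x + w := funext hFw
    have := congrArg (fun g => deriv g x) h
    simpa [deriv_comp_add_const] using this
  have hper2 : Function.Periodic (deriv (deriv F)) 1 := by
    intro x
    have h : (fun x => deriv F (x + 1)) = fun x => deriv F x := funext hper1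
    have := congrArg (fun g => deriv g x) h
    simpa [deriv_comp_add_const] using this
  obtain ⟨K, hK⟩ : ∃ K : ℝ, ∀ x, ‖deriv (deriv F) x‖ ≤ K := by
    obtain ⟨K, hK⟩ := (hper2.isBounded_of_continuous one_ne_zero hd2).exists_norm_le
    exact ⟨K, fun x => hK _ ⟨x, rfl⟩⟩
  have hK0 : 0 ≤ K := (norm_nonneg _).trans (hK 0)
  have hpos : ∀ x, 0 < deriv F x := fun x => by linarith [hexp x]
  have hlog : ∀ x y, |log (deriv F x) - log (deriv F y)| ≤ K * |x - y| := by
    intro x y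
    have := Convex.norm_image_sub_le_of_norm_deriv_le (f := fun x => log (deriv F x)) (C := K)
      (s := univ) (x := y) (y := x) (fun z _ => (hdd z).log (hpos z).ne') (fun z _ => by
        rw [deriv.log (hdd z) (hpos z).ne', norm_div]
        have h1 : 1 ≤ ‖deriv F z‖ := by
          rw [Real.norm_of_nonneg (hpos z).le]; linarith [hexp z]
        exact (div_le_self (norm_nonneg _) h1).trans (hK z)) convex_univ trivial trivial
    simpa using this
  -- expansion
  have hmono : ∀ x y, x ≤ y → lam * (y - x) ≤ F y - F x := fun x y hxy =>
    mul_sub_le_image_sub_of_le_deriv hd hexp hxy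
  have hsm : StrictMono F := fun x y hxy => by
    have := hmono x y hxy.le
    nlinarith
  have hexp' : ∀ x y, lam * |x - y| ≤ |F x - F y| := by
    intro x y
    rcases le_total x y with h | h
    · rw [abs_sub_comm x, abs_sub_comm (F x), abs_of_nonneg (sub_nonneg.2 h)]
      exact (hmono x y h).trans (le_abs_self _)
    · rw [abs_of_nonneg (sub_nonneg.2 h)]
      exact (hmono y x h).trans (le_abs_self _)
  have hsurj : Function.Surjective F := by
    apply hd.continuous.surjective
    · apply tendsto_atTop_mono' atTop (f₁ := fun x => lam * x + F 0)
      · filter_upwards [eventually_ge_atTop 0] with x hx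
        linarith [hmono 0 x hx]
      · exact tendsto_atTop_add_const_right _ _ (tendsto_id.const_mul_atTop (by linarith))
    · refine tendsto_atBot_mono' atBot (?_ : F ≤ᶠ[atBot] fun x => lam * x + F 0) ?_
      · filter_upwards [eventually_le_atBot 0] with x hx
        linarith [hmono x 0 hx]
      · exact tendsto_atBot_add_const_right _ _ (tendsto_id.const_mul_atBot (by linarith))
  -- distortion
  let S : ℕ → ℝ → ℝ := fun n x => ∑ k ∈ Finset.range n, log (deriv F (F^[k] x))
  have hS : ∀ n x, HasDerivAt (F^[n]) (exp (S n x)) x := by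
    intro n
    induction n with
    | zero => intro x; simpa [S] using hasDerivAt_id x
    | succ n ih =>
      intro x
      rw [Function.iterate_succ']
      have := (hd (F^[n] x)).hasDerivAt.comp x (ih x)
      have e : exp (S (n + 1) x) = deriv F (F^[n] x) * exp (S n x) := by
        simp only [S, Finset.sum_range_succ]
        rw [exp_add, exp_log (hpos _), mul_comm]
      rw [e]
      exact this
  set C := K / (lam - 1) with hC
  have hC0 : 0 ≤ C := div_nonneg hK0 (by linarith)
  have hCK : C + K = lam * C := by
    rw [hC]; field_simp [show lam - 1 ≠ 0 by linarith]; ring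
  have hdist : ∀ n x y, |S n x - S n y| ≤ C * |F^[n] x - F^[n] y| := by
    intro n x y
    induction n with
    | zero => simp only [S]; simp; positivity
    | succ n ih =>
      have h1 := hlog (F^[n] x) (F^[n] y)
      have h2 := hexp' (F^[n] x) (F^[n] y)
      have e : S (n+1) x - S (n+1) y = (S n x - S n y) +
        (log (deriv F (F^[n] x)) - log (deriv F (F^[n] y))) := by
        simp only [S, Finset.sum_range_succ]; ring
      rw [e, Function.iterate_succ_apply', Function.iterate_succ_apply']
      calc _ ≤ C * |F^[n] x - F^[n] y| + K * |F^[n] x - F^[n] y| :=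
            (abs_add_le _ _).trans (add_le_add ih h1)
        _ = C * (lam * |F^[n] x - F^[n] y|) := by rw [← add_mul, hCK]; ring
        _ ≤ _ := mul_le_mul_of_nonneg_left h2 hC0
  have hexpn : ∀ n x y, lam ^ n * |x - y| ≤ |F^[n] x - F^[n] y| := by
    intro n x y
    induction n with
    | zero => simp
    | succ n ih =>
      rw [Function.iterate_succ_apply', Function.iterate_succ_apply', pow_succ']
      have h2 := hexp' (F^[n] x) (F^[n] y)
      have : lam * (lam ^ n * |x - y|) ≤ lam * |F^[n] x - F^[n] y| :=
        mul_le_mul_of_nonneg_left ih (by linarith)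
      linarith
  have hinvn : ∀ n x, F^[n] x ∈ A ↔ x ∈ A := by
    intro n x
    induction n with
    | zero => simp
    | succ n ih =>
      rw [Function.iterate_succ_apply', ← ih]
      exact Set.ext_iff.1 hinv _
  -- density point
  obtain ⟨x₀, hx₀A, hx₀⟩ : ∃ x₀ ∈ Aᶜ, Tendsto (fun a => volume (A ∩ a) / volume a)
      ((IsUnifLocDoublingMeasure.vitaliFamily (volume : Measure ℝ) 1).filterAt x₀)
      (𝓝 (A.indicator 1 x₀)) := by
    have h := (IsUnifLocDoublingMeasure.vitaliFamily
      (volume : Measure ℝ) 1).ae_tendsto_measure_inter_div_of_measurableSet hA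
    by_contra! hcon
    apply hAc
    refine measure_mono_null (fun x hx => ?_) h
    exact hcon x hx
  rw [indicator_of_notMem hx₀A] at hx₀
  have hex : ∀ n, ∃ a b, F^[n] a = F^[n] x₀ - 1/2 ∧ F^[n] b = F^[n] x₀ + 1/2 := fun n => by
    obtain ⟨a, ha⟩ := hsurj.iterate n (F^[n] x₀ - 1/2)
    obtain ⟨b, hb⟩ := hsurj.iterate n (F^[n] x₀ + 1/2)
    exact ⟨a, b, ha, hb⟩
  choose a b ha hb using hex
  have hax : ∀ n, a n < x₀ := fun n => (hsm.iterate n).lt_iff_lt.1 (by rw [ha]; linarith)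
  have hbx : ∀ n, x₀ < b n := fun n => (hsm.iterate n).lt_iff_lt.1 (by rw [hb]; linarith)
  have hball : ∀ n, Metric.closedBall ((a n + b n) / 2) ((b n - a n) / 2) = Icc (a n) (b n) := by
    intro n
    rw [Real.closedBall_eq_Icc]; congr 1 <;> ring
  have hlen : ∀ n, b n - a n ≤ (lam⁻¹) ^ n := by
    intro n
    have := hexpn n (b n) (a n)
    rw [ha, hb, show F^[n] x₀ + 1/2 - (F^[n] x₀ - 1/2) = 1 by ring, abs_one] at this
    rw [inv_pow, ← one_div, le_div_iff₀ (by positivity)]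
    have h3 := le_abs_self (b n - a n)
    have h4 : 0 < lam ^ n := by positivity
    nlinarith
  have hδ : Tendsto (fun n => (b n - a n) / 2) atTop (𝓝[>] 0) := by
    rw [tendsto_nhdsWithin_iff]
    refine ⟨?_, Eventually.of_forall fun n => by
      have := hax n; have := hbx n; simp only [mem_Ioi]; linarith⟩
    refine squeeze_zero (fun n => by linarith [hax n, hbx n]) (fun n => ?_)
      (tendsto_pow_atTop_nhds_zero_of_lt_one (inv_nonneg.2 (by linarith : 0 ≤ lam))
        (inv_lt_one_of_one_lt₀ hlam))
    linarith [hlen n, hax n, hbx n]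
  have hlim := hx₀.comp (IsUnifLocDoublingMeasure.tendsto_closedBall_filterAt volume
    (K := 1) (x := x₀) (fun n => (a n + b n) / 2) (fun n => (b n - a n) / 2) hδ
    (Eventually.of_forall fun n => by
      rw [one_mul, hball]; exact ⟨(hax n).le, (hbx n).le⟩))
  have hlim2 := ENNReal.Tendsto.const_mul (a := ENNReal.ofReal (exp (2 * C))) hlim
    (Or.inr ENNReal.ofReal_ne_top)
  rw [mul_zero] at hlim2
  have hle : M ≤ 0 := by
    refine ge_of_tendsto' hlim2 fun n => ?_
    simp only [Function.comp, hball]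
    rw [Real.volume_Icc]
    have hab : 0 < b n - a n := by linarith [hax n, hbx n]
    have hmemd : ∀ x ∈ Icc (a n) (b n), |F^[n] x - F^[n] x₀| ≤ 1 := by
      intro x hx
      have h1 := (hsm.iterate n).monotone hx.1
      have h2 := (hsm.iterate n).monotone hx.2
      rw [ha] at h1
      rw [hb] at h2
      rw [abs_le]; constructor <;> linarith
    have hSd : ∀ x ∈ Icc (a n) (b n), |S n x - S n x₀| ≤ C := fun x hx =>
      (hdist n x x₀).trans (by nlinarith [hmemd x hx])
    have hup : exp (S n x₀ + C) ≤ exp (2 * C) / (b n - a n) := by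
      obtain ⟨c, hc, hce⟩ := exists_hasDerivAt_eq_slope (F^[n]) (fun x => exp (S n x))
        (by linarith : a n < b n) (fun x _ => (hS n x).continuousAt.continuousWithinAt)
        (fun x _ => hS n x)
      rw [ha, hb, show F^[n] x₀ + 1/2 - (F^[n] x₀ - 1/2) = 1 by ring] at hce
      have : exp (2 * C) / (b n - a n) = exp (2 * C) * exp (S n c) := by
        rw [hce]; ring
      rw [this, ← exp_add, exp_le_exp]
      have := abs_le.1 (hSd c ⟨hc.1.le, hc.2.le⟩)
      linarith [this.1]
    have hms : MeasurableSet (A ∩ Icc (a n) (b n)) := hA.inter measurableSet_Icc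
    calc M = volume (A ∩ Ioc (F^[n] x₀ - 1/2) (F^[n] x₀ - 1/2 + 1)) := (hM _).symm
      _ ≤ volume (F^[n] '' (A ∩ Icc (a n) (b n))) := by
        apply measure_mono
        rintro y ⟨hyA, hy1, hy2⟩
        obtain ⟨x, rfl⟩ := hsurj.iterate n y
        refine ⟨x, ⟨(hinvn n x).1 hyA, ?_, ?_⟩, rfl⟩
        · exact (hsm.iterate n).le_iff_le.1 (by rw [ha]; exact hy1.le)
        · exact (hsm.iterate n).le_iff_le.1 (by rw [hb]; linarith)
      _ = ∫⁻ x in A ∩ Icc (a n) (b n), ENNReal.ofReal (exp (S n x)) :=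
        (lintegral_deriv_eq_volume_image_of_monotoneOn hms
          (fun x _ => (hS n x).hasDerivWithinAt) ((hsm.iterate n).monotone.monotoneOn _)).symm
      _ ≤ ∫⁻ x in A ∩ Icc (a n) (b n), ENNReal.ofReal (exp (2 * C) / (b n - a n)) := by
        apply setLIntegral_mono' hms
        intro x hx
        apply ENNReal.ofReal_le_ofReal
        refine le_trans (exp_le_exp.2 ?_) hup
        linarith [(abs_le.1 (hSd x hx.2)).2]
      _ = _ := by
        rw [setLIntegral_const, ENNReal.ofReal_div_of_pos hab, div_eq_mul_inv, div_eq_mul_inv,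
          mul_assoc, mul_comm (volume _)]
  exact le_antisymm hle bot_le

theorem ergodic_acim_unique
    (F : ℝ → ℝ) (hF : ContDiff ℝ 2 F)
    (w : ℕ) (hw : 0 < w) (hFw : ∀ x : ℝ, F (x + 1) = F x + w)
    (T : UnitAddCircle → UnitAddCircle) (hT : ∀ x : ℝ, T ↑x = (↑(F x) : UnitAddCircle))
    (lam : ℝ) (hlam : 1 < lam) (hexp : ∀ x : ℝ, lam ≤ deriv F x) :
    ∀ ν₁ ν₂ : Measure UnitAddCircle,
      IsProbabilityMeasure ν₁ → IsProbabilityMeasure ν₂ →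
      (∀ A : Set UnitAddCircle, MeasurableSet A → ν₁ (T ⁻¹' A) = ν₁ A) →
      (∀ A : Set UnitAddCircle, MeasurableSet A → ν₂ (T ⁻¹' A) = ν₂ A) →
      (∀ A : Set UnitAddCircle, MeasurableSet A → T ⁻¹' A = A → ν₁ A = 0 ∨ ν₁ A = 1) →
      (∀ A : Set UnitAddCircle, MeasurableSet A → T ⁻¹' A = A → ν₂ A = 0 ∨ ν₂ A = 1) →
      ν₁ ≪ volume → ν₂ ≪ volume → ν₁ = ν₂ := by
  intro ν₁ ν₂ _ _ h1 h2 _ _ hac1 hac2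
  have hTc : Continuous T := by
    have hq : Topology.IsQuotientMap (fun x : ℝ => (x : UnitAddCircle)) :=
      QuotientAddGroup.isQuotientMap_mk _
    rw [hq.continuous_iff]
    have : T ∘ (fun x : ℝ => (x : UnitAddCircle)) = fun x => (F x : UnitAddCircle) := funext hT
    rw [this]
    exact (AddCircle.continuous_mk' 1).comp hF.continuous
  have hTm : Measurable T := hTc.measurable
  have hp1 : MeasurePreserving T ν₁ ν₁ :=
    ⟨hTm, Measure.ext fun s hs => by rw [Measure.map_apply hTm hs, h1 s hs]⟩
  have hp2 : MeasurePreserving T ν₂ ν₂ :=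
    ⟨hTm, Measure.ext fun s hs => by rw [Measure.map_apply hTm hs, h2 s hs]⟩
  have hadd : ∀ {μ ν : Measure UnitAddCircle}, MeasurePreserving T μ μ → MeasurePreserving T ν ν →
      MeasurePreserving T (μ + ν) (μ + ν) := fun hμ hν =>
    ⟨hTm, by rw [Measure.map_add _ _ hTm, hμ.map_eq, hν.map_eq]⟩
  have hmk : Measurable (fun x : ℝ => (x : UnitAddCircle)) :=
    (AddCircle.continuous_mk' 1).measurable
  have h01 : ∀ A : Set UnitAddCircle, MeasurableSet A → T ⁻¹' A = A →
      volume A = 0 ∨ volume Aᶜ = 0 := by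
    intro A hA hinv
    have hvol : ∀ B : Set UnitAddCircle, MeasurableSet B → ∀ t : ℝ,
        volume ((fun x : ℝ => (x : UnitAddCircle)) ⁻¹' B ∩ Set.Ioc t (t + 1)) = volume B := by
      intro B hB t
      rw [← Measure.restrict_apply (hmk hB)]
      exact (UnitAddCircle.measurePreserving_mk t).measure_preimage hB.nullMeasurableSet
    by_cases hz : volume ((fun x : ℝ => (x : UnitAddCircle)) ⁻¹' A)ᶜ = 0
    · right
      rw [← hvol _ hA.compl 0]
      exact measure_mono_null Set.inter_subset_left hz
    · left
      refine acim_zero_one F hF w hFw lam hlam hexp _ (hmk hA) ?_ _ (hvol A hA) hz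
      ext x
      have := Set.ext_iff.1 hinv (x : UnitAddCircle)
      rw [Set.mem_preimage, hT] at this
      exact this
  have hac : ν₁ + ν₂ ≪ volume := hac1.add_left hac2
  have herg : Ergodic T (ν₁ + ν₂) :=
    { hadd hp1 hp2 with
      aeconst_set := fun s hs hinv => by
        rw [Filter.eventuallyConst_set]
        rcases h01 s hs hinv with h | h
        · right
          exact measure_eq_zero_iff_ae_notMem.1 (hac h)
        · left
          exact mem_ae_iff.2 (hac h) }
  have e1 : ν₁ + ν₁ = ν₁ + ν₂ := herg.eq_of_absolutelyContinuous_measure_univ_eq (hadd hp1 hp1)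
    (Measure.AbsolutelyContinuous.add_left (.add_right .rfl _) (.add_right .rfl _)) (by simp)
  ext s hs
  have := congrArg (fun μ => μ s) e1
  simp only [Measure.add_apply] at this
  exact (ENNReal.add_right_inj (measure_ne_top ν₁ s)).1 this
end
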